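/- arXiv:1807.08104 — 7 statements merged into one kernel-verified Lean document; each statement's English description precedes it below -/
import Mathlib

section
/- If m ≥ n ≥ 2 and m ≥ k, then γ_{×k,t}(K_n □ K_m) ≤ k·n. -/
open SimpleGraph

/-- The `n × m` rook's graph, i.e. the Cartesian product `K_n □ K_m`. -/
def rook (n m : ℕ) : SimpleGraph (Fin n × Fin m) :=
  (⊤ : SimpleGraph (Fin n)) □ (⊤ : SimpleGraph (Fin m))

/-- `S` is a `k`-tuple total dominating set of `G`: every vertex has at least `k`
neighbours in `S`. -/
def IsTDS {V : Type*} (G : SimpleGraph V) (k : ℕ) (S : Set V) : Prop :=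
  ∀ v : V, k ≤ (S ∩ G.neighborSet v).ncard

/-- The `k`-tuple total domination number `γ_{×k,t}(K_n □ K_m)`. -/
noncomputable def gammaXt (k n m : ℕ) : ℕ :=
  sInf {c | ∃ S : Set (Fin n × Fin m), IsTDS (rook n m) k S ∧ S.ncard = c}


/-- The full columns with index below `k` form a `k`-tuple total dominating set of the rook's
graph. -/
lemma isTDS_rook_columns {k n m : ℕ} (hn : 2 ≤ n) (hkm : k ≤ m) :
    IsTDS (rook n m) k (Set.range fun p : Fin n × Fin k => (p.1, Fin.castLE hkm p.2)) := by
  rintro ⟨r, c⟩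
  have : Nontrivial (Fin n) := Fin.nontrivial_iff_two_le.mpr hn
  obtain ⟨r', hr⟩ := exists_ne r
  let f : Fin k → Fin n × Fin m := fun j =>
    (if Fin.castLE hkm j = c then r' else r, Fin.castLE hkm j)
  have hf : Function.Injective f := fun i j h =>
    Fin.castLE_injective hkm (congrArg Prod.snd h)
  calc k = (Set.range f).ncard := by
        rw [Set.ncard_range_of_injective hf, Nat.card_fin]
    _ ≤ _ := by
        refine Set.ncard_le_ncard ?_ (Set.toFinite _)
        rintro _ ⟨j, rfl⟩
        refine ⟨⟨(_, j), rfl⟩, ?_⟩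
        by_cases h : Fin.castLE hkm j = c
        · simp [f, rook, h, hr.symm]
        · simp [f, rook, h, Ne.symm h]

theorem stmt_2 (k n m : ℕ) (hn : 2 ≤ n) (hnm : n ≤ m) (hkm : k ≤ m) :
    gammaXt k n m ≤ k * n := by
  have h : gammaXt k n m ≤ _ := Nat.sInf_le ⟨_, isTDS_rook_columns hn hkm, rfl⟩
  refine h.trans ?_
  rw [← Set.image_univ]
  refine (Set.ncard_image_le Set.finite_univ).trans ?_
  simp [Set.ncard_univ, Nat.mul_comm]
end

section
/- If m ≥ n ≥ 2, m ≥ k, and moreover m ≥ k·n − 1, then γ_{×k,t}(K_n □ K_m) = k·n. -/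
open SimpleGraph

/-- In a rook's graph, the neighbours of `(i, j)` in `T` together with two copies of `(i, j)`, in
case it lies in `T`, are counted by the row and the column of `T` through `(i, j)`. -/
theorem ncard_inter_rook_neighborSet {n m : ℕ} (T : Finset (Fin n × Fin m))
    (i : Fin n) (j : Fin m) :
    ((T : Set (Fin n × Fin m)) ∩ (rook n m).neighborSet (i, j)).ncard
        + 2 * (if (i, j) ∈ T then 1 else 0)
      = (T.filter (fun p => p.1 = i)).card + (T.filter (fun p => p.2 = j)).card := by
  have hset : (T : Set (Fin n × Fin m)) ∩ (rook n m).neighborSet (i, j)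
      = (((T.filter (fun p => p.1 = i)).erase (i, j) ∪
          (T.filter (fun p => p.2 = j)).erase (i, j) : Finset (Fin n × Fin m)) :
          Set (Fin n × Fin m)) := by
    ext ⟨a, b⟩
    simp [rook, SimpleGraph.boxProd_adj]
    grind
  have hdisj : Disjoint ((T.filter (fun p => p.1 = i)).erase (i, j))
      ((T.filter (fun p => p.2 = j)).erase (i, j)) := by
    rw [Finset.disjoint_left]
    rintro ⟨a, b⟩ h1 h2
    simp at h1 h2
    grind
  rw [hset, Set.ncard_coe_finset, Finset.card_union_of_disjoint hdisj]
  by_cases h : (i, j) ∈ T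
  · have h1 : (i, j) ∈ T.filter (fun p => p.1 = i) := by simp [h]
    have h2 : (i, j) ∈ T.filter (fun p => p.2 = j) := by simp [h]
    rw [← Finset.card_erase_add_one h1, ← Finset.card_erase_add_one h2]
    simp only [h, if_true]
    ring
  · rw [Finset.erase_eq_of_notMem (by simp [h]), Finset.erase_eq_of_notMem (by simp [h])]
    simp [h]

/-- `k` full columns of the `n × m` rook's graph are a `k`-tuple total dominating set. -/
theorem exists_isTDS_rook_ncard_eq {k n m : ℕ} (hn : 2 ≤ n) (hkm : k ≤ m) :
    ∃ S : Set (Fin n × Fin m), IsTDS (rook n m) k S ∧ S.ncard = k * n := by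
  have hk : (Finset.univ.filter (fun b : Fin m => b.val < k)).card = k := by
    simp [Fin.card_filter_val_lt, hkm]
  refine ⟨((Finset.univ ×ˢ Finset.univ.filter (fun b : Fin m => b.val < k) :
    Finset (Fin n × Fin m)) : Set (Fin n × Fin m)), ?_, ?_⟩
  · rintro ⟨i, j⟩
    have key := ncard_inter_rook_neighborSet
      (Finset.univ ×ˢ Finset.univ.filter (fun b : Fin m => b.val < k)) i j
    have hrow : ((Finset.univ ×ˢ Finset.univ.filter (fun b : Fin m => b.val < k)).filter
        (fun p : Fin n × Fin m => p.1 = i)).card = k := by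
      have : (Finset.univ ×ˢ Finset.univ.filter (fun b : Fin m => b.val < k)).filter
          (fun p : Fin n × Fin m => p.1 = i)
          = {i} ×ˢ Finset.univ.filter (fun b : Fin m => b.val < k) := by
        ext ⟨a, b⟩
        simp
        grind
      rw [this, Finset.card_product, hk, Finset.card_singleton, one_mul]
    rw [hrow] at key
    by_cases hj : j.val < k
    · have hcol : ((Finset.univ ×ˢ Finset.univ.filter (fun b : Fin m => b.val < k)).filter
          (fun p : Fin n × Fin m => p.2 = j)).card = n := by
        have : (Finset.univ ×ˢ Finset.univ.filter (fun b : Fin m => b.val < k)).filter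
            (fun p : Fin n × Fin m => p.2 = j) = Finset.univ ×ˢ {j} := by
          ext ⟨a, b⟩
          simp
          grind
        rw [this, Finset.card_product]
        simp
      rw [hcol] at key
      split_ifs at key <;> omega
    · rw [if_neg (by simp; omega)] at key
      omega
  · rw [Set.ncard_coe_finset, Finset.card_product, hk, Finset.card_univ, Fintype.card_fin,
      mul_comm]

/-- Summing the domination condition along a row that meets `T` in `r` vertices. -/
theorem mul_add_two_mul_le_card_add_mul {k n m : ℕ} {T : Finset (Fin n × Fin m)}
    (hT : IsTDS (rook n m) k (T : Set (Fin n × Fin m))) (i : Fin n) :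
    m * k + 2 * (T.filter (fun p => p.1 = i)).card
      ≤ m * (T.filter (fun p => p.1 = i)).card + T.card := by
  have hcol : T.card = ∑ j : Fin m, (T.filter (fun p => p.2 = j)).card :=
    Finset.card_eq_sum_card_fiberwise (by simp [Set.MapsTo])
  have hrow : (T.filter (fun p => p.1 = i)).card
      = ∑ j : Fin m, if (i, j) ∈ T then 1 else 0 := by
    rw [← Finset.card_filter]
    refine Finset.card_bij' (fun p _ => p.2) (fun j _ => (i, j)) ?_ ?_ ?_ ?_ <;> simp <;> grind
  have hsum := Finset.sum_le_sum (s := Finset.univ) fun (j : Fin m) _ =>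
    (Nat.add_le_add_right (hT (i, j)) (2 * if (i, j) ∈ T then 1 else 0)).trans_eq
      (ncard_inter_rook_neighborSet T i j)
  simpa only [Finset.sum_add_distrib, ← Finset.mul_sum, ← hcol, ← hrow, Finset.sum_const,
    Finset.card_univ, Fintype.card_fin, smul_eq_mul] using hsum

theorem mul_le_card_of_isTDS_rook {k n m : ℕ} (hn : 2 ≤ n) (hnm : n ≤ m)
    (hbig : k * n - 1 ≤ m) {T : Finset (Fin n × Fin m)}
    (hT : IsTDS (rook n m) k (T : Set (Fin n × Fin m))) : k * n ≤ T.card := by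
  by_contra! hlt
  obtain ⟨i, hi⟩ : ∃ i : Fin n, (T.filter (fun p => p.1 = i)).card < k := by
    by_contra! hall
    have hsum : T.card = ∑ i : Fin n, (T.filter (fun p => p.1 = i)).card :=
      Finset.card_eq_sum_card_fiberwise (by simp [Set.MapsTo])
    have hle := Finset.sum_le_sum (s := Finset.univ) fun (i : Fin n) _ => hall i
    rw [← hsum, Finset.sum_const, Finset.card_univ, Fintype.card_fin, smul_eq_mul, mul_comm] at hle
    omega
  have key := mul_add_two_mul_le_card_add_mul hT i
  obtain ⟨d, hd⟩ := Nat.exists_eq_add_of_lt hi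
  generalize (T.filter (fun p => p.1 = i)).card = r at *
  have hmk : m * k = m * r + m * d + m := by rw [hd]; ring
  have hd0 : d = 0 := by
    by_contra hne
    have := Nat.le_mul_of_pos_right m (Nat.pos_of_ne_zero hne)
    omega
  have hr0 : r = 0 := by omega
  obtain rfl : k = 1 := by omega
  omega

theorem stmt_3 (k n m : ℕ) (hn : 2 ≤ n) (hnm : n ≤ m) (hkm : k ≤ m)
    (hbig : k * n - 1 ≤ m) :
    gammaXt k n m = k * n := by
  refine IsLeast.csInf_eq ⟨exists_isTDS_rook_ncard_eq hn hkm, ?_⟩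
  rintro c ⟨S, hS, rfl⟩
  lift S to Finset (Fin n × Fin m) using S.toFinite
  rw [Set.ncard_coe_finset]
  exact mul_le_card_of_isTDS_rook hn hnm hbig hS
end

section
/- Let m ≥ n ≥ 6 with (n,m) ≠ (6,6), and let k with 0 ≤ k ≤ 9 be such that 2n ≡ 3m + k (mod 10). Then γ_{×3,t}(K_n □ K_m) ≤ ⌈(8n+3m)/5⌉ if k ∈ {0,1,2,3,4,7,8,9}, and γ_{×3,t}(K_n □ K_m) ≤ ⌈(8n+3m)/5⌉ + 1 if k ∈ {5,6}. -/
open SimpleGraph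

/-- To bound `γ_{×k,t}(K_n □ K_m)` by `c`, it suffices to give at most `c` cells of the `n × m`
grid such that each cell shares its row or its column with `k` other chosen cells. -/
lemma gammaXt_le_of_cells {k n m c : ℕ} (F : Finset (ℕ × ℕ)) (hc : F.card ≤ c)
    (hF : ∀ a ∈ F, a.1 < n ∧ a.2 < m)
    (h : ∀ i < n, ∀ j < m,
      k ≤ (F.filter fun a => (a.1 = i ∧ a.2 ≠ j) ∨ (a.2 = j ∧ a.1 ≠ i)).card) :
    gammaXt k n m ≤ c := by
  let f : Fin n × Fin m → ℕ × ℕ := fun v => (v.1.val, v.2.val)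
  have hf : Function.Injective f := by
    rintro ⟨a, b⟩ ⟨c, d⟩ hv
    simpa [f, Fin.ext_iff] using hv
  have hS : (f ⁻¹' (F : Set (ℕ × ℕ))).ncard ≤ c := by
    rw [← Set.ncard_image_of_injective _ hf]
    refine (Set.ncard_le_ncard (Set.image_preimage_subset f _) F.finite_toSet).trans ?_
    rwa [Set.ncard_coe_finset]
  refine le_trans (Nat.sInf_le ⟨f ⁻¹' (F : Set (ℕ × ℕ)), ?_, rfl⟩) hS
  rintro ⟨i, j⟩
  refine (h i i.2 j j.2).trans ?_
  rw [← Set.ncard_image_of_injective _ hf, ← Set.ncard_coe_finset]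
  refine Set.ncard_le_ncard ?_ (Set.toFinite _)
  rintro ⟨x, y⟩ ha
  simp only [Finset.coe_filter, Set.mem_ofPred_eq] at ha
  obtain ⟨haF, had⟩ := ha
  obtain ⟨hx, hy⟩ := hF _ haF
  refine ⟨(⟨x, hx⟩, ⟨y, hy⟩), ⟨haF, ?_⟩, rfl⟩
  simp only [rook, SimpleGraph.mem_neighborSet, SimpleGraph.boxProd_adj, SimpleGraph.top_adj,
    ne_eq, Fin.ext_iff]
  rcases had with ⟨h1, h2⟩ | ⟨h1, h2⟩
  · exact Or.inr ⟨fun e => h2 e.symm, h1.symm⟩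
  · exact Or.inl ⟨fun e => h2 e.symm, h1.symm⟩

/-- Three full columns form a 3-tuple total dominating set. -/
lemma gammaXt_three_le_three_mul {n m : ℕ} (hn : 4 ≤ n) (hm : 3 ≤ m) :
    gammaXt 3 n m ≤ 3 * n := by
  refine gammaXt_le_of_cells (Finset.range n ×ˢ Finset.range 3) (by simp [mul_comm]) ?_ ?_
  · intro a ha
    simp only [Finset.mem_product, Finset.mem_range] at ha
    omega
  · intro i hi j hj
    refine Nat.succ_le_of_lt (Finset.two_lt_card.2 ?_)
    simp only [Finset.mem_filter, Finset.mem_product, Finset.mem_range]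
    by_cases h3 : 3 ≤ j
    · exact ⟨(i, 0), by grind, (i, 1), by grind, (i, 2), by grind, by simp, by simp, by simp⟩
    · refine ⟨(if i = 0 then 3 else 0, j), by grind, (if i = 1 then 3 else 1, j), by grind,
        (if i = 2 then 3 else 2, j), by grind, ?_, ?_, ?_⟩ <;> grind

/-- The first `p` rows partition the first `t` columns into parts of size at least four, while
each of the other rows has two cells, spread cyclically over the last `b` columns. -/
lemma gammaXt_three_le_of_blocks {n p t b : ℕ} (hp : 1 ≤ p) (hpn : p ≤ n) (ht : 4 * p ≤ t)
    (hb : 2 ≤ b) (hnb : 3 * b ≤ 2 * (n - p)) :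
    gammaXt 3 n (t + b) ≤ t + 2 * (n - p) := by
  let F : Finset (ℕ × ℕ) := (Finset.range t).image (fun j => (min (j / 4) (p - 1), j)) ∪
    (Finset.range (2 * (n - p))).image (fun e => (p + e / 2, t + e % b))
  have top : ∀ j < t, (min (j / 4) (p - 1), j) ∈ F := fun j hj =>
    Finset.mem_union_left _ (Finset.mem_image.2 ⟨j, Finset.mem_range.2 hj, rfl⟩)
  have bot : ∀ e < 2 * (n - p), (p + e / 2, t + e % b) ∈ F := fun e he =>
    Finset.mem_union_right _ (Finset.mem_image.2 ⟨e, Finset.mem_range.2 he, rfl⟩)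
  have column : ∀ d < b, (p + d / 2, t + d) ∈ F ∧ (p + (d + b) / 2, t + d) ∈ F ∧
      (p + (d + 2 * b) / 2, t + d) ∈ F := by
    intro d hd
    have h0 := bot d (by omega)
    have h1 := bot (d + b) (by omega)
    have h2 := bot (d + 2 * b) (by omega)
    rw [Nat.mod_eq_of_lt hd] at h0
    rw [Nat.add_mod_right, Nat.mod_eq_of_lt hd] at h1
    rw [Nat.add_mul_mod_self_right, Nat.mod_eq_of_lt hd] at h2
    exact ⟨h0, h1, h2⟩
  have row : ∀ i < n, p ≤ i → ∃ x y, x ≠ y ∧ t ≤ x ∧ t ≤ y ∧ (i, x) ∈ F ∧ (i, y) ∈ F := by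
    intro i hi hpi
    have h0 := bot (2 * (i - p)) (by omega)
    have h1 := bot (2 * (i - p) + 1) (by omega)
    rw [show p + 2 * (i - p) / 2 = i by omega] at h0
    rw [show p + (2 * (i - p) + 1) / 2 = i by omega] at h1
    refine ⟨_, _, ?_, Nat.le_add_right _ _, Nat.le_add_right _ _, h0, h1⟩
    intro he
    have hmod : 2 * (i - p) ≡ 2 * (i - p) + 1 [MOD b] := Nat.add_left_cancel he
    have hdvd := (Nat.modEq_iff_dvd' (Nat.le_succ _)).1 hmod
    have := Nat.le_of_dvd (by omega) hdvd
    omega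
  refine gammaXt_le_of_cells F ?_ ?_ ?_
  · refine (Finset.card_union_le _ _).trans (add_le_add ?_ ?_)
    · exact Finset.card_image_le.trans (by simp)
    · exact Finset.card_image_le.trans (by simp)
  · intro a ha
    simp only [F, Finset.mem_union, Finset.mem_image, Finset.mem_range] at ha
    rcases ha with ⟨j, hj, rfl⟩ | ⟨e, he, rfl⟩
    · exact ⟨by dsimp only; omega, by dsimp only; omega⟩
    · have := Nat.mod_lt e (by omega : 0 < b)
      exact ⟨by dsimp only; omega, by dsimp only; omega⟩
  · intro i hi j hj
    refine Nat.succ_le_of_lt (Finset.two_lt_card.2 ?_)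
    simp only [Finset.mem_filter]
    by_cases hip : i < p
    · by_cases hjt : j < t
      · have cell : ∀ s < 4, (i, 4 * i + s) ∈ F := by
          intro s hs
          have := top (4 * i + s) (by omega)
          rwa [show min ((4 * i + s) / 4) (p - 1) = i by omega] at this
        have h0 := cell 0 (by omega)
        have h1 := cell 1 (by omega)
        have h2 := cell 2 (by omega)
        have h3 := cell 3 (by omega)
        refine ⟨(i, 4 * i + if j = 4 * i + 0 then 3 else 0), by grind,
          (i, 4 * i + if j = 4 * i + 1 then 3 else 1), by grind,
          (i, 4 * i + if j = 4 * i + 2 then 3 else 2), by grind, ?_, ?_, ?_⟩ <;> grind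
      · obtain ⟨d, rfl⟩ := Nat.exists_eq_add_of_le (not_lt.1 hjt)
        obtain ⟨h0, h1, h2⟩ := column d (by omega)
        refine ⟨_, ⟨h0, ?_⟩, _, ⟨h1, ?_⟩, _, ⟨h2, ?_⟩, ?_, ?_, ?_⟩ <;>
          grind
    · obtain ⟨x, y, hxy, hx, hy, hxF, hyF⟩ := row i hi (by omega)
      by_cases hjt : j < t
      · refine ⟨_, ⟨top j hjt, ?_⟩, _, ⟨hxF, ?_⟩, _, ⟨hyF, ?_⟩, ?_, ?_, ?_⟩ <;>
          grind
      · obtain ⟨d, rfl⟩ := Nat.exists_eq_add_of_le (not_lt.1 hjt)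
        obtain ⟨h0, h1, h2⟩ := column d (by omega)
        obtain ⟨z, hz, hzF⟩ : ∃ z, z ≠ t + d ∧ (i, z) ∈ F := by
          by_cases hxd : x = t + d
          · exact ⟨y, by omega, hyF⟩
          · exact ⟨x, hxd, hxF⟩
        by_cases e0 : i = p + d / 2
        · refine ⟨_, ⟨hzF, ?_⟩, _, ⟨h1, ?_⟩, _, ⟨h2, ?_⟩, ?_, ?_, ?_⟩ <;>
            grind
        · by_cases e1 : i = p + (d + b) / 2
          · refine ⟨_, ⟨h0, ?_⟩, _, ⟨hzF, ?_⟩, _, ⟨h2, ?_⟩, ?_, ?_, ?_⟩ <;>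
              grind
          · by_cases e2 : i = p + (d + 2 * b) / 2
            · refine ⟨_, ⟨h0, ?_⟩, _, ⟨h1, ?_⟩, _, ⟨hzF, ?_⟩, ?_, ?_, ?_⟩ <;>
                grind
            · refine ⟨_, ⟨h0, ?_⟩, _, ⟨h1, ?_⟩, _, ⟨h2, ?_⟩, ?_, ?_, ?_⟩ <;>
                grind

lemma gammaXt_three_six_nine_le : gammaXt 3 6 9 ≤ 16 := by
  refine gammaXt_le_of_cells
    ({0} ×ˢ Finset.Ico 0 4 ∪ Finset.Ico 1 3 ×ˢ Finset.Ico 4 7 ∪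
      Finset.Ico 3 6 ×ˢ Finset.Ico 7 9) ?_ ?_ ?_ <;> decide +kernel

lemma gammaXt_three_seven_thirteen_le : gammaXt 3 7 13 ≤ 20 := by
  refine gammaXt_le_of_cells
    ({0} ×ˢ Finset.Ico 0 4 ∪ {1} ×ˢ Finset.Ico 4 8 ∪ Finset.Ico 2 4 ×ˢ Finset.Ico 8 11 ∪
      Finset.Ico 4 7 ×ˢ Finset.Ico 11 13) ?_ ?_ ?_ <;> decide +kernel

theorem stmt_4 (n m k : ℕ) (hn : 6 ≤ n) (hnm : n ≤ m) (hne : (n, m) ≠ (6, 6))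
    (hk : k ≤ 9) (hmod : (2 * n) % 10 = (3 * m + k) % 10) :
    (k ∈ ({0, 1, 2, 3, 4, 7, 8, 9} : Set ℕ) →
      gammaXt 3 n m ≤ (8 * n + 3 * m + 4) / 5) ∧
    (k ∈ ({5, 6} : Set ℕ) →
      gammaXt 3 n m ≤ (8 * n + 3 * m + 4) / 5 + 1) := by
  obtain ⟨a, ha⟩ : ∃ a, 10 * a + 2 * n = 3 * m + k := ⟨(3 * m + k - 2 * n) / 10, by omega⟩
  have wide := gammaXt_three_le_three_mul (n := n) (m := m) (by omega) (by omega)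
  have even_bound (hk6 : k ≤ 6) : gammaXt 3 n m ≤ 2 * n + 2 * a := by
    by_cases h3 : 3 * n ≤ 2 * n + 2 * a
    · exact wide.trans h3
    · by_cases hb : 4 * a + 2 ≤ m
      · have := gammaXt_three_le_of_blocks (n := n) (p := a) (t := 4 * a) (b := m - 4 * a)
          (by omega) (by omega) le_rfl (by omega) (by omega)
        rw [show 4 * a + (m - 4 * a) = m by omega] at this
        omega
      · have hcases : (n = 6 ∧ m = 9 ∧ a = 2) ∨ (n = 7 ∧ m = 13 ∧ a = 3) := by
          have hn8 : n ≤ 8 := by omega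
          interval_cases n <;> omega
        rcases hcases with ⟨rfl, rfl, rfl⟩ | ⟨rfl, rfl, rfl⟩
        · exact gammaXt_three_six_nine_le
        · exact gammaXt_three_seven_thirteen_le
  have odd_bound (hk7 : 7 ≤ k) : gammaXt 3 n m ≤ 2 * n + 2 * a - 1 := by
    by_cases h3 : 3 * n ≤ 2 * n + 2 * a - 1
    · exact wide.trans h3
    · have := gammaXt_three_le_of_blocks (n := n) (p := a - 1) (t := 4 * a - 3)
        (b := m - (4 * a - 3)) (by omega) (by omega) (by omega) (by omega) (by omega)
      rw [show 4 * a - 3 + (m - (4 * a - 3)) = m by omega] at this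
      omega
  simp only [Set.mem_insert_iff, Set.mem_singleton_iff]
  refine ⟨fun hmem => ?_, fun hmem => ?_⟩
  · by_cases hk6 : k ≤ 6
    · have := even_bound hk6
      omega
    · have := odd_bound (by omega)
      omega
  · have := even_bound (by omega)
    omega
end

section
/- For all m ≥ n ≥ 3, γ_{×3,t}(K_n □ K_m) ≥ 2n + 2. -/
open SimpleGraph

/-- If some row of `f` has sum `r ≤ 1`, summing the domination condition along that row
bounds the total of `f` from below. -/
theorem two_mul_card_add_two_le_of_row_le_one {α β : Type*} [Fintype α] [Fintype β]
    (hβ : 2 ≤ Fintype.card β) (f : α → β → ℕ)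
    (hf : ∀ i j, 3 + 2 * f i j ≤ ∑ b, f i b + ∑ a, f a j)
    {i : α} (hi : ∑ b, f i b ≤ 1) :
    2 * Fintype.card β + 2 ≤ ∑ b, ∑ a, f a b := by
  have h : ∑ j : β, (3 + 2 * f i j) ≤ ∑ j : β, (∑ b, f i b + ∑ a, f a j) :=
    Finset.sum_le_sum fun j _ => hf i j
  simp only [Finset.sum_add_distrib, ← Finset.mul_sum, Finset.sum_const, Finset.card_univ,
    smul_eq_mul] at h
  interval_cases hr : ∑ b, f i b <;> omega

theorem two_mul_card_add_two_le_sum {α β : Type*} [Fintype α] [Fintype β]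
    (hα : 2 ≤ Fintype.card α) (hαβ : Fintype.card α ≤ Fintype.card β) (f : α → β → ℕ)
    (hf : ∀ i j, 3 + 2 * f i j ≤ ∑ b, f i b + ∑ a, f a j) :
    2 * Fintype.card α + 2 ≤ ∑ a, ∑ b, f a b := by
  by_cases hcol : ∃ j, ∑ a, f a j ≤ 1
  · obtain ⟨j, hj⟩ := hcol
    exact two_mul_card_add_two_le_of_row_le_one hα (fun b a => f a b)
      (fun j i => (hf i j).trans_eq (add_comm _ _)) hj
  by_cases hrow : ∃ i, ∑ b, f i b ≤ 1
  · obtain ⟨i, hi⟩ := hrow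
    have := two_mul_card_add_two_le_of_row_le_one (hα.trans hαβ) f hf hi
    rw [Finset.sum_comm]
    omega
  push Not at hcol hrow
  by_cases hrow' : ∃ i, ∑ b, f i b = 2
  · obtain ⟨i, hi⟩ := hrow'
    have h : ∑ j : β, (2 + f i j) ≤ ∑ j, ∑ a, f a j :=
      Finset.sum_le_sum fun j _ => by
        have := hf i j
        have := hcol j
        omega
    simp only [Finset.sum_add_distrib, Finset.sum_const, Finset.card_univ, smul_eq_mul, hi] at h
    rw [Finset.sum_comm]
    omega
  · push Not at hrow'
    have h : ∑ _i : α, 3 ≤ ∑ a, ∑ b, f a b :=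
      Finset.sum_le_sum fun i _ => by
        have := hrow i
        have := hrow' i
        omega
    simp only [Finset.sum_const, Finset.card_univ, smul_eq_mul] at h
    omega

open Classical in
theorem ncard_inter_rook_neighborSet_le {n m : ℕ} (S : Set (Fin n × Fin m)) (i : Fin n)
    (j : Fin m) :
    (S ∩ (rook n m).neighborSet (i, j)).ncard + 2 * (if (i, j) ∈ S then 1 else 0) ≤
      (∑ b, if (i, b) ∈ S then 1 else 0) + ∑ a, if (a, j) ∈ S then 1 else 0 := by
  simp only [← Finset.card_filter]
  set R : Finset (Fin m) := Finset.univ.filter fun b => (i, b) ∈ S with hR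
  set C : Finset (Fin n) := Finset.univ.filter fun a => (a, j) ∈ S with hC
  have hsub : S ∩ (rook n m).neighborSet (i, j) ⊆
      (((R.erase j).image (Prod.mk i) ∪ (C.erase i).image (·, j) : Finset _) :
        Set (Fin n × Fin m)) := by
    rintro ⟨a, b⟩ ⟨hS, hadj⟩
    simp only [rook, mem_neighborSet, boxProd_adj, top_adj] at hadj
    rcases hadj with ⟨hne, rfl⟩ | ⟨hne, rfl⟩
    · simp [hC, hS, Ne.symm hne]
    · simp [hR, hS, Ne.symm hne]
  have hle := Set.ncard_le_ncard hsub (Finset.finite_toSet _)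
  rw [Set.ncard_coe_finset] at hle
  have hunion := hle.trans ((Finset.card_union_le _ _).trans
    (add_le_add Finset.card_image_le Finset.card_image_le))
  by_cases hij : (i, j) ∈ S
  · have hjR : j ∈ R := by simp [hR, hij]
    have hiC : i ∈ C := by simp [hC, hij]
    have := Finset.card_erase_add_one hjR
    have := Finset.card_erase_add_one hiC
    simp only [hij, if_true]
    omega
  · have := Finset.card_erase_le (s := R) (a := j)
    have := Finset.card_erase_le (s := C) (a := i)
    simp only [hij, if_false]
    omega

open Classical in
theorem IsTDS.two_mul_add_two_le_ncard {n m : ℕ} (hn : 2 ≤ n) (hnm : n ≤ m)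
    {S : Set (Fin n × Fin m)} (hS : IsTDS (rook n m) 3 S) : 2 * n + 2 ≤ S.ncard := by
  have h := two_mul_card_add_two_le_sum (α := Fin n) (β := Fin m) (by simpa) (by simpa)
    (fun a b => if (a, b) ∈ S then 1 else 0) fun i j => by
      have := hS (i, j)
      have := ncard_inter_rook_neighborSet_le S i j
      omega
  rw [Fintype.card_fin, ← Fintype.sum_prod_type' (f := fun a b => if (a, b) ∈ S then 1 else 0),
    ← Finset.card_filter] at h
  rwa [Set.ncard_eq_toFinset_card', ← Set.filter_mem_univ_eq_toFinset]

theorem isTDS_rook_univ {n m : ℕ} (hn : 3 ≤ n) (hm : 3 ≤ m) :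
    IsTDS (rook n m) 3 Set.univ := by
  classical
  rintro ⟨i, j⟩
  rw [Set.univ_inter, rook, Set.ncard_eq_toFinset_card', ← neighborFinset_def,
    card_neighborFinset_eq_degree, degree_boxProd, complete_graph_degree, complete_graph_degree,
    Fintype.card_fin, Fintype.card_fin]
  omega

theorem stmt_6 (n m : ℕ) (hn : 3 ≤ n) (hnm : n ≤ m) :
    2 * n + 2 ≤ gammaXt 3 n m := by
  obtain ⟨S, hS, hcard⟩ := Nat.sInf_mem (s := {c | ∃ S : Set (Fin n × Fin m),
    IsTDS (rook n m) 3 S ∧ S.ncard = c}) ⟨_, _, isTDS_rook_univ hn (hn.trans hnm), rfl⟩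
  exact (hS.two_mul_add_two_le_ncard (by omega) hnm).trans_eq hcard
end

section
/- For all m ≥ n ≥ 3, γ_{×3,t}(K_n □ K_m) ≤ γ_{×3,t}(K_n □ K_{m+1}) ≤ γ_{×3,t}(K_n □ K_m) + 1. -/
open SimpleGraph

open Finset

section Degrees

variable {α β : Type*}

/-- The number of cells of `S` in row `i`. -/
def rowDeg [DecidableEq α] (S : Finset (α × β)) (i : α) : ℕ := #{p ∈ S | p.1 = i}

/-- The number of cells of `S` in column `j`. -/
def colDeg [DecidableEq β] (S : Finset (α × β)) (j : β) : ℕ := #{p ∈ S | p.2 = j}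

/-- The condition on row and column sums that characterises 3-tuple total dominating sets
of a rook's graph. -/
def Dominating [DecidableEq α] [DecidableEq β] (S : Finset (α × β)) : Prop :=
  ∀ i j, 3 ≤ rowDeg S i + colDeg S j ∧ ((i, j) ∈ S → 5 ≤ rowDeg S i + colDeg S j)

theorem card_le_rowDeg [DecidableEq α] [DecidableEq β] {S : Finset (α × β)} {i : α} {t : ℕ}
    (f : Fin t → β)
    (hf : Function.Injective f) (hS : ∀ a, (i, f a) ∈ S) : t ≤ rowDeg S i := by
  have : #(univ.image fun a => (i, f a)) ≤ rowDeg S i := by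
    apply card_le_card
    intro p hp
    obtain ⟨a, -, rfl⟩ := mem_image.1 hp
    simp [hS a]
  rwa [card_image_of_injective _ (fun a b h => hf (Prod.ext_iff.1 h).2), card_fin] at this

theorem card_le_colDeg [DecidableEq α] [DecidableEq β] {S : Finset (α × β)} {j : β} {t : ℕ}
    (f : Fin t → α)
    (hf : Function.Injective f) (hS : ∀ a, (f a, j) ∈ S) : t ≤ colDeg S j := by
  have : #(univ.image fun a => (f a, j)) ≤ colDeg S j := by
    apply card_le_card
    intro p hp
    obtain ⟨a, -, rfl⟩ := mem_image.1 hp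
    simp [hS a]
  rwa [card_image_of_injective _ (fun a b h => hf (Prod.ext_iff.1 h).1), card_fin] at this

theorem rowDeg_pos [DecidableEq α] {S : Finset (α × β)} {i : α} {j : β} (h : (i, j) ∈ S)
    : 1 ≤ rowDeg S i :=
  card_pos.2 ⟨(i, j), by simp [h]⟩

theorem colDeg_pos [DecidableEq β] {S : Finset (α × β)} {i : α} {j : β} (h : (i, j) ∈ S)
    : 1 ≤ colDeg S j :=
  card_pos.2 ⟨(i, j), by simp [h]⟩

theorem rowDeg_mono [DecidableEq α] {S T : Finset (α × β)} (h : S ⊆ T) (i : α)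
    : rowDeg S i ≤ rowDeg T i :=
  card_le_card (filter_subset_filter _ h)

theorem colDeg_mono [DecidableEq β] {S T : Finset (α × β)} (h : S ⊆ T) (j : β)
    : colDeg S j ≤ colDeg T j :=
  card_le_card (filter_subset_filter _ h)

theorem rowDeg_insert [DecidableEq α] [DecidableEq β] {S : Finset (α × β)} {i : α} {j : β}
    (h : (i, j) ∉ S) :
    rowDeg (insert (i, j) S) i = rowDeg S i + 1 := by
  unfold rowDeg
  rw [filter_insert, if_pos rfl, card_insert_of_notMem (by simp [h])]

theorem sum_rowDeg [DecidableEq α] [Fintype α] (S : Finset (α × β)) : ∑ i, rowDeg S i = #S :=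
  (card_eq_sum_card_fiberwise (fun _ _ => mem_coe.2 (mem_univ _))).symm

theorem sum_colDeg [DecidableEq β] [Fintype β] (S : Finset (α × β)) : ∑ j, colDeg S j = #S :=
  (card_eq_sum_card_fiberwise (fun _ _ => mem_coe.2 (mem_univ _))).symm

theorem rowDeg_image_swap [DecidableEq α] [DecidableEq β] (S : Finset (α × β)) (j : β) :
    rowDeg (S.image Prod.swap) j = colDeg S j := by
  unfold rowDeg colDeg
  rw [filter_image, card_image_of_injective _ Prod.swap_injective]
  rfl

theorem colDeg_image_swap [DecidableEq α] [DecidableEq β] (S : Finset (α × β)) (i : α) :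
    colDeg (S.image Prod.swap) i = rowDeg S i := by
  unfold rowDeg colDeg
  rw [filter_image, card_image_of_injective _ Prod.swap_injective]
  rfl

theorem Dominating.image_swap [DecidableEq α] [DecidableEq β] {S : Finset (α × β)}
    (h : Dominating S) :
    Dominating (S.image Prod.swap) := by
  intro i j
  rw [rowDeg_image_swap, colDeg_image_swap, add_comm]
  refine ⟨(h j i).1, fun hm => (h j i).2 ?_⟩
  obtain ⟨p, hp, he⟩ := mem_image.1 hm
  rwa [← Prod.swap_swap p, he] at hp

/-- If all rows are nonempty and all columns have at least two cells, assigning weight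
`3 / r + 8 / c ≤ 5` to each cell bounds the size of a dominating set. -/
theorem Dominating.weighted_card_le [DecidableEq α] [DecidableEq β] [Fintype α] [Fintype β]
    {S : Finset (α × β)}
    (h : Dominating S) (hr : ∀ i, 1 ≤ rowDeg S i) (hc : ∀ j, 2 ≤ colDeg S j) :
    3 * Fintype.card α + 8 * Fintype.card β ≤ 5 * #S := by
  have h1 : ∑ p ∈ S, (1 : ℚ) / rowDeg S p.1 = Fintype.card α := by
    rw [← sum_fiberwise (s := S) (g := Prod.fst), Fintype.card_eq_sum_ones, Nat.cast_sum]
    refine sum_congr rfl fun i _ => ?_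
    rw [sum_congr rfl (g := fun _ => (1 : ℚ) / rowDeg S i)
      (fun p hp => by rw [(mem_filter.1 hp).2]), sum_const, nsmul_eq_mul]
    have := hr i
    have h0 : (rowDeg S i : ℚ) ≠ 0 := by positivity
    change (rowDeg S i : ℚ) * _ = _
    field_simp
    simp
  have h2 : ∑ p ∈ S, (1 : ℚ) / colDeg S p.2 = Fintype.card β := by
    rw [← sum_fiberwise (s := S) (g := Prod.snd), Fintype.card_eq_sum_ones, Nat.cast_sum]
    refine sum_congr rfl fun j _ => ?_
    rw [sum_congr rfl (g := fun _ => (1 : ℚ) / colDeg S j)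
      (fun p hp => by rw [(mem_filter.1 hp).2]), sum_const, nsmul_eq_mul]
    have := hc j
    have h0 : (colDeg S j : ℚ) ≠ 0 := by positivity
    change (colDeg S j : ℚ) * _ = _
    field_simp
    simp
  have h3 : ∑ p ∈ S, (3 * ((1 : ℚ) / rowDeg S p.1) + 8 * ((1 : ℚ) / colDeg S p.2)) ≤
      ∑ _p ∈ S, (5 : ℚ) := by
    refine sum_le_sum fun p hp => ?_
    have hs := (h p.1 p.2).2 hp
    have hr' := hr p.1
    have hc' := hc p.2
    generalize rowDeg S p.1 = r at *
    generalize colDeg S p.2 = c at *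
    have key : 3 * c + 8 * r ≤ 5 * (r * c) := by
      rcases Nat.lt_or_ge r 3 with hlt | hge
      · interval_cases r <;> omega
      · nlinarith
    have hr0 : (0 : ℚ) < r := by exact_mod_cast hr'
    have hc0 : (0 : ℚ) < c := by exact_mod_cast (by omega : 0 < c)
    have key' : (3 * c + 8 * r : ℚ) ≤ 5 * (r * c) := by exact_mod_cast key
    have : 3 * ((1 : ℚ) / r) + 8 * (1 / c) = (3 * c + 8 * r) / (r * c) := by field_simp
    rw [this, div_le_iff₀ (by positivity)]
    exact key'
  rw [sum_add_distrib, ← mul_sum, ← mul_sum, h1, h2, sum_const, nsmul_eq_mul] at h3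
  have : ((3 * Fintype.card α + 8 * Fintype.card β : ℕ) : ℚ) ≤ ((5 * #S : ℕ) : ℚ) := by
    push_cast
    linarith
  exact_mod_cast this

end Degrees

theorem isTDS_rook_iff {n m : ℕ} (S : Finset (Fin n × Fin m)) :
    IsTDS (rook n m) 3 (S : Set (Fin n × Fin m)) ↔ Dominating S := by
  have key : ∀ i j, ((S : Set (Fin n × Fin m)) ∩ (rook n m).neighborSet (i, j)).ncard +
      (if (i, j) ∈ S then 2 else 0) = rowDeg S i + colDeg S j := by
    intro i j
    have he : (S : Set (Fin n × Fin m)) ∩ (rook n m).neighborSet (i, j) =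
        ((({p ∈ S | p.1 = i}).erase (i, j) ∪ ({p ∈ S | p.2 = j}).erase (i, j) :
          Finset (Fin n × Fin m)) : Set (Fin n × Fin m)) := by
      ext ⟨a, b⟩
      simp only [rook, Set.mem_inter_iff, mem_coe, SimpleGraph.mem_neighborSet,
        SimpleGraph.boxProd_adj, SimpleGraph.top_adj, mem_union, mem_erase, mem_filter, ne_eq,
        Prod.mk.injEq]
      grind
    have hd : Disjoint (({p ∈ S | p.1 = i}).erase (i, j)) (({p ∈ S | p.2 = j}).erase (i, j)) := by
      rw [Finset.disjoint_left]
      rintro ⟨a, b⟩ h1 h2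
      simp only [mem_erase, mem_filter, ne_eq, Prod.mk.injEq] at h1 h2
      grind
    rw [he, Set.ncard_coe_finset, card_union_of_disjoint hd, card_erase_eq_ite, card_erase_eq_ite]
    by_cases hm : (i, j) ∈ S
    · have h1 := rowDeg_pos hm
      have h2 := colDeg_pos hm
      unfold rowDeg colDeg at *
      simp only [mem_filter, hm, and_self, if_true]
      omega
    · simp [hm, rowDeg, colDeg]
  constructor
  · intro h i j
    have h1 := h (i, j)
    have h2 := key i j
    split_ifs at h2 with hm
    · exact ⟨by omega, fun _ => by omega⟩
    · exact ⟨by omega, fun h => absurd h hm⟩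
  · rintro h ⟨i, j⟩
    have h1 := h i j
    have h2 := key i j
    split_ifs at h2 with hm
    · have := h1.2 hm
      omega
    · have := h1.1
      omega

theorem gammaXt_le_of_dominating {n m s : ℕ} {S : Finset (Fin n × Fin m)} (h : Dominating S)
    (hs : #S ≤ s) : gammaXt 3 n m ≤ s := by
  refine le_trans (Nat.sInf_le ?_) hs
  exact ⟨(S : Set (Fin n × Fin m)), (isTDS_rook_iff S).2 h, Set.ncard_coe_finset S⟩

theorem exists_dominating_card_le_three_mul {n m : ℕ} (hn : 3 ≤ n) (hm : 3 ≤ m) :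
    ∃ S : Finset (Fin n × Fin m), Dominating S ∧ #S ≤ 3 * n := by
  let S : Finset (Fin n × Fin m) :=
    (univ : Finset (Fin n × Fin 3)).image (Prod.map id (Fin.castLE hm))
  have hmem : ∀ i a, (i, Fin.castLE hm a) ∈ S := fun i a =>
    mem_image.2 ⟨(i, a), mem_univ _, rfl⟩
  refine ⟨S, fun i j => ?_, card_image_le.trans (by simp [mul_comm])⟩
  have hr : 3 ≤ rowDeg S i := card_le_rowDeg (Fin.castLE hm) (Fin.castLE_injective hm) (hmem i)
  refine ⟨by omega, fun hij => ?_⟩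
  obtain ⟨⟨a, b⟩, -, hab⟩ := mem_image.1 hij
  obtain ⟨-, rfl⟩ := Prod.ext_iff.1 hab
  have hc : n ≤ colDeg S (Fin.castLE hm b) :=
    card_le_colDeg id Function.injective_id (fun i => hmem i b)
  simp only [Prod.map_snd]
  omega

theorem exists_dominating_card_eq_gammaXt {n m : ℕ} (hn : 3 ≤ n) (hm : 3 ≤ m) :
    ∃ S : Finset (Fin n × Fin m), Dominating S ∧ #S = gammaXt 3 n m := by
  obtain ⟨S₀, h₀, -⟩ := exists_dominating_card_le_three_mul hn hm
  have hne : {c | ∃ S : Set (Fin n × Fin m), IsTDS (rook n m) 3 S ∧ S.ncard = c}.Nonempty :=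
    ⟨_, (S₀ : Set (Fin n × Fin m)), (isTDS_rook_iff S₀).2 h₀, rfl⟩
  obtain ⟨S, hS, hc⟩ := Nat.sInf_mem hne
  classical
  refine ⟨S.toFinset, (isTDS_rook_iff _).1 (by simpa using hS), ?_⟩
  rw [← Set.ncard_eq_toFinset_card']
  exact hc

/-- A dominating set made of `y` rows with at least four cells each, which meet all columns
from the `k`-th on, and of `n - y` rows with two cells each, all lying in the first `k` columns. -/
theorem exists_dominating_of_parameters {n m y k l : ℕ} (hy : 1 ≤ y) (hyn : y ≤ n) (hk : 2 ≤ k)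
    (hkm : k ≤ m) (hkn : 3 * k ≤ 2 * (n - y)) (hl : 4 * y ≤ l) (hlm : l ≤ m) (hlk : m ≤ l + k) :
    ∃ S : Finset (Fin n × Fin m), Dominating S ∧ #S ≤ 2 * (n - y) + l := by
  let f : Fin (2 * (n - y)) → Fin n × Fin m := fun x =>
    (⟨y + x / 2, by omega⟩, ⟨x % k, (Nat.mod_lt _ (by omega)).trans_le hkm⟩)
  let g : Fin l → Fin n × Fin m := fun x =>
    (⟨x % y, (Nat.mod_lt _ (by omega)).trans_le hyn⟩,
      ⟨if k + x < m then k + x else k + x - m, by split_ifs <;> omega⟩)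
  let S : Finset (Fin n × Fin m) := univ.image f ∪ univ.image g
  have hfS : ∀ x, f x ∈ S := fun x => mem_union_left _ (mem_image_of_mem _ (mem_univ _))
  have hgS : ∀ x, g x ∈ S := fun x => mem_union_right _ (mem_image_of_mem _ (mem_univ _))
  have hrow2 : ∀ i : Fin n, y ≤ i → 2 ≤ rowDeg S i := by
    intro i hi
    have hmem : ∀ a : Fin 2, (i, (f ⟨2 * (i - y) + a, by omega⟩).2) ∈ S := by
      intro a
      convert hfS ⟨2 * (i - y) + a, by omega⟩ using 1
      refine Prod.ext (Fin.ext ?_) rfl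
      change (i : ℕ) = y + (2 * (i - y) + a) / 2
      omega
    refine card_le_rowDeg _ ?_ hmem
    have hne : (2 * ((i : ℕ) - y)) % k ≠ (2 * (i - y) + 1) % k := by
      intro h
      have h1 : (2 * ((i : ℕ) - y) + 1 - 2 * (i - y)) % k = 0 :=
        Nat.sub_mod_eq_zero_of_mod_eq h.symm
      rw [Nat.add_sub_cancel_left, Nat.mod_eq_of_lt (by omega)] at h1
      omega
    intro a b hab
    have h : (2 * ((i : ℕ) - y) + a) % k = (2 * (i - y) + b) % k := congrArg Fin.val hab
    fin_cases a <;> fin_cases b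
    exacts [rfl, absurd h hne, absurd h.symm hne, rfl]
  have hrow4 : ∀ i : Fin n, (i : ℕ) < y → 4 ≤ rowDeg S i := by
    intro i hi
    have hlt : ∀ a : Fin 4, i + (a : ℕ) * y < l := by
      intro a
      have : (a : ℕ) * y ≤ 3 * y := Nat.mul_le_mul_right y (Nat.le_of_lt_succ a.isLt)
      omega
    have hmem : ∀ a : Fin 4, (i, (g ⟨i + (a : ℕ) * y, hlt a⟩).2) ∈ S := by
      intro a
      convert hgS ⟨i + (a : ℕ) * y, hlt a⟩ using 1
      refine Prod.ext (Fin.ext ?_) rfl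
      change (i : ℕ) = (i + (a : ℕ) * y) % y
      rw [Nat.add_mul_mod_self_right, Nat.mod_eq_of_lt hi]
    refine card_le_rowDeg _ ?_ hmem
    intro a b hab
    have ha := hlt a
    have hb := hlt b
    have h : (if k + (i + (a : ℕ) * y) < m then k + (i + (a : ℕ) * y) else k + (i + (a : ℕ) * y) - m) =
      (if k + (i + (b : ℕ) * y) < m then k + (i + (b : ℕ) * y) else k + (i + (b : ℕ) * y) - m) :=
      congrArg Fin.val hab
    have h' : (a : ℕ) * y = b * y := by split_ifs at h <;> omega
    exact Fin.ext (Nat.eq_of_mul_eq_mul_right hy h')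
  have hcol3 : ∀ j : Fin m, (j : ℕ) < k → 3 ≤ colDeg S j := by
    intro j hj
    have hlt : ∀ a : Fin 3, j + (a : ℕ) * k < 2 * (n - y) := by
      intro a
      have : (a : ℕ) * k ≤ 2 * k := Nat.mul_le_mul_right k (Nat.le_of_lt_succ a.isLt)
      omega
    have hmem : ∀ a : Fin 3, ((f ⟨j + (a : ℕ) * k, hlt a⟩).1, j) ∈ S := by
      intro a
      convert hfS ⟨j + (a : ℕ) * k, hlt a⟩ using 1
      refine Prod.ext rfl (Fin.ext ?_)
      change (j : ℕ) = (j + (a : ℕ) * k) % k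
      rw [Nat.add_mul_mod_self_right, Nat.mod_eq_of_lt hj]
    refine card_le_colDeg _ ?_ hmem
    intro a b hab
    have h : y + (j + (a : ℕ) * k) / 2 = y + (j + (b : ℕ) * k) / 2 := congrArg Fin.val hab
    have h' : (a : ℕ) = b := by
      rcases lt_trichotomy (a : ℕ) b with hab | hab | hab
      · have : (a + 1 : ℕ) * k ≤ b * k := Nat.mul_le_mul_right _ hab
        rw [add_one_mul] at this
        omega
      · exact hab
      · have : (b + 1 : ℕ) * k ≤ a * k := Nat.mul_le_mul_right _ hab
        rw [add_one_mul] at this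
        omega
    exact Fin.ext h'
  have hcol1 : ∀ j : Fin m, 1 ≤ colDeg S j := by
    intro j
    rcases lt_or_ge (j : ℕ) k with hj | hj
    · exact (by omega : 1 ≤ 3).trans (hcol3 j hj)
    · have : g ⟨j - k, by omega⟩ = ((g ⟨j - k, by omega⟩).1, j) := by
        refine Prod.ext rfl (Fin.ext ?_)
        change (if k + ((j : ℕ) - k) < m then k + ((j : ℕ) - k) else k + ((j : ℕ) - k) - m) = j
        split_ifs <;> omega
      exact colDeg_pos (this ▸ hgS _)
  refine ⟨S, fun i j => ?_, ?_⟩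
  · have hc := hcol1 j
    rcases lt_or_ge (i : ℕ) y with hi | hi
    · have := hrow4 i hi
      omega
    · have hr := hrow2 i hi
      refine ⟨by omega, fun hij => ?_⟩
      have hjk : (j : ℕ) < k := by
        rcases mem_union.1 hij with h | h
        · obtain ⟨x, -, hx⟩ := mem_image.1 h
          have : (x : ℕ) % k = j := congrArg (fun p => (p.2 : ℕ)) hx
          rw [← this]
          exact Nat.mod_lt _ (by omega)
        · obtain ⟨x, -, hx⟩ := mem_image.1 h
          have h1 : (x : ℕ) % y = i := congrArg (fun p => (p.1 : ℕ)) hx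
          have := Nat.mod_lt (x : ℕ) hy
          omega
      have := hcol3 j hjk
      omega
  · refine (card_union_le _ _).trans (add_le_add ?_ ?_)
    · exact card_image_le.trans (by simp)
    · exact card_image_le.trans (by simp)

theorem gammaXt_le_of_weighted {n m s : ℕ} (hn : 3 ≤ n) (hnm : n ≤ m)
    (hs : 3 * n ≤ s ∨ 8 * n + 3 * m + 7 ≤ 5 * s) : gammaXt 3 n m ≤ s := by
  by_cases hs3 : 3 * n ≤ s
  · obtain ⟨S, hS, hc⟩ := exists_dominating_card_le_three_mul hn (hn.trans hnm)
    exact gammaXt_le_of_dominating hS (hc.trans hs3)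
  · rcases eq_or_lt_of_le hn with rfl | hn4
    · obtain rfl : m = 3 := by omega
      refine gammaXt_le_of_dominating (S := univ.erase (0, 0)) ?_ ?_
      · unfold Dominating
        decide
      · rw [card_erase_of_mem (mem_univ _), card_univ, Fintype.card_prod, Fintype.card_fin]
        omega
    · obtain ⟨y, hy⟩ : ∃ y, y = max 1 ((3 * m - 2 * n) / 10) := ⟨_, rfl⟩
      obtain ⟨k, hk⟩ : ∃ k, k = 2 * (n - y) / 3 := ⟨_, rfl⟩
      obtain ⟨l, hl⟩ : ∃ l, l = max (4 * y) (m - k) := ⟨_, rfl⟩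
      obtain ⟨S, hS, hc⟩ := exists_dominating_of_parameters (n := n) (m := m) (y := y) (k := k)
        (l := l) (by omega) (by omega) (by omega) (by omega) (by omega) (by omega) (by omega)
        (by omega)
      exact gammaXt_le_of_dominating hS (hc.trans (by omega))

theorem Dominating.three_mul_le_or_weighted_le {n m : ℕ} {S : Finset (Fin n × Fin m)}
    (h : Dominating S) (hc : ∀ j, 2 ≤ colDeg S j) :
    3 * m ≤ #S ∨ 3 * n + 8 * m ≤ 5 * #S := by
  by_cases hr : ∀ i, 1 ≤ rowDeg S i
  · right
    simpa using h.weighted_card_le hr hc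
  · left
    push Not at hr
    obtain ⟨i, hi⟩ := hr
    have : ∑ _j : Fin m, 3 ≤ ∑ j, colDeg S j := sum_le_sum fun j _ => by
      have := (h i j).1
      omega
    rw [sum_colDeg] at this
    simpa [mul_comm] using this

theorem Dominating.exists_three_le_rowDeg {n m : ℕ} {S : Finset (Fin n × Fin m)}
    (hn : 1 ≤ n) (hnm : n ≤ m) (h : Dominating S) : ∃ i, 3 ≤ rowDeg S i := by
  by_contra! hr
  have h1 : ∑ i, rowDeg S i ≤ ∑ _i : Fin n, 2 := sum_le_sum fun i _ => by
    have := hr i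
    omega
  have h2 : ∑ _j : Fin m, 3 ≤ ∑ j, colDeg S j := sum_le_sum fun j _ => by
    have hpos : 1 ≤ colDeg S j := by
      have := (h ⟨0, hn⟩ j).1
      have := hr ⟨0, hn⟩
      omega
    obtain ⟨⟨a, b⟩, hp⟩ := card_pos.1 hpos
    obtain ⟨hS, rfl⟩ := mem_filter.1 hp
    have := (h a b).2 hS
    have := hr a
    dsimp only at *
    omega
  rw [sum_rowDeg] at h1
  rw [sum_colDeg] at h2
  simp at h1 h2
  omega

theorem gammaXt_succ_le_of_two_le_rowDeg {n m : ℕ} {S : Finset (Fin n × Fin m)} (hn : 1 ≤ n)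
    (hnm : n ≤ m) (h : Dominating S) (hr : ∀ i, 2 ≤ rowDeg S i) :
    gammaXt 3 n (m + 1) ≤ #S + 1 := by
  obtain ⟨i₀, hi₀⟩ := h.exists_three_le_rowDeg hn hnm
  let e : Fin n × Fin m → Fin n × Fin (m + 1) := Prod.map id Fin.castSucc
  have he : Function.Injective e :=
    Function.injective_id.prodMap (Fin.castSucc_injective m)
  let U := S.image e
  have hUr : ∀ i, rowDeg U i = rowDeg S i := fun i => by
    change #(filter _ (image e S)) = _
    rw [filter_image, card_image_of_injective _ he]
    rfl
  have hUc : ∀ j, colDeg U (Fin.castSucc j) = colDeg S j := fun j => by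
    change #(filter _ (image e S)) = _
    rw [filter_image, card_image_of_injective _ he]
    simp [e, colDeg]
  have hlast : ∀ i, (i, Fin.last m) ∉ U := by
    intro i hi
    obtain ⟨p, -, hp⟩ := mem_image.1 hi
    exact Fin.castSucc_ne_last p.2 (congrArg Prod.snd hp)
  have hr' : ∀ i, rowDeg S i ≤ rowDeg (insert (i₀, Fin.last m) U) i := fun i =>
    hUr i ▸ rowDeg_mono (subset_insert _ _) i
  refine gammaXt_le_of_dominating (S := insert (i₀, Fin.last m) U) (fun i j => ?_)
    ((card_insert_le _ _).trans (Nat.add_le_add_right card_image_le 1))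
  have hri := hr' i
  have hrS := hr i
  induction j using Fin.lastCases with
  | last =>
    have hc := colDeg_pos (mem_insert_self (i₀, Fin.last m) U)
    refine ⟨by omega, fun hij => ?_⟩
    rcases mem_insert.1 hij with hij | hij
    · obtain ⟨rfl, -⟩ := Prod.ext_iff.1 hij
      have := rowDeg_insert (hlast i)
      have := hUr i
      dsimp only at *
      omega
    · exact absurd hij (hlast i)
  | cast j =>
    have hc : colDeg S j ≤ colDeg (insert (i₀, Fin.last m) U) (Fin.castSucc j) :=
      hUc j ▸ colDeg_mono (subset_insert _ _) _
    have hS := h i j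
    refine ⟨by omega, fun hij => ?_⟩
    rcases mem_insert.1 hij with hij | hij
    · exact absurd (congrArg Prod.snd hij) (Fin.castSucc_ne_last j)
    · obtain ⟨p, hp, hpe⟩ := mem_image.1 hij
      have : p = (i, j) := he hpe
      have := hS.2 (this ▸ hp)
      omega

theorem gammaXt_succ_le {n m : ℕ} (hn : 3 ≤ n) (hnm : n ≤ m) :
    gammaXt 3 n (m + 1) ≤ gammaXt 3 n m + 1 := by
  obtain ⟨S, hS, hcard⟩ := exists_dominating_card_eq_gammaXt hn (hn.trans hnm)
  rw [← hcard]
  by_cases hr : ∀ i, 2 ≤ rowDeg S i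
  · exact gammaXt_succ_le_of_two_le_rowDeg (by omega) hnm hS hr
  · push Not at hr
    obtain ⟨i, hi⟩ := hr
    have hc : ∀ j, 2 ≤ colDeg S j := fun j => by
      have := (hS i j).1
      omega
    rcases eq_or_lt_of_le hnm with rfl | hlt
    · rw [← card_image_of_injective S Prod.swap_injective]
      exact gammaXt_succ_le_of_two_le_rowDeg (by omega) le_rfl hS.image_swap
        (fun i => (rowDeg_image_swap S i).symm ▸ hc i)
    · have := hS.three_mul_le_or_weighted_le hc
      exact gammaXt_le_of_weighted hn (by omega) (by omega)

section DeleteColumn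

variable {n m : ℕ}

/-- The set of cells obtained from `S` by deleting column `j₀`. -/
def deleteColumn (S : Finset (Fin n × Fin (m + 1))) (j₀ : Fin (m + 1)) : Finset (Fin n × Fin m) :=
  {p | (p.1, j₀.succAbove p.2) ∈ S}

theorem mem_deleteColumn {S : Finset (Fin n × Fin (m + 1))} {j₀ : Fin (m + 1)} {i : Fin n}
    {j : Fin m} : (i, j) ∈ deleteColumn S j₀ ↔ (i, j₀.succAbove j) ∈ S := by
  simp [deleteColumn]

theorem prodMap_succAbove_injective (j₀ : Fin (m + 1)) :
    Function.Injective (Prod.map (id : Fin n → Fin n) j₀.succAbove) :=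
  Function.injective_id.prodMap Fin.succAbove_right_injective

theorem image_deleteColumn (S : Finset (Fin n × Fin (m + 1))) (j₀ : Fin (m + 1)) :
    (deleteColumn S j₀).image (Prod.map id j₀.succAbove) = {p ∈ S | p.2 ≠ j₀} := by
  ext ⟨i, j⟩
  simp only [mem_image, mem_filter, Prod.exists, Prod.map_apply, id, Prod.mk.injEq,
    mem_deleteColumn]
  constructor
  · rintro ⟨a, b, h, rfl, rfl⟩
    exact ⟨h, Fin.succAbove_ne _ _⟩
  · rintro ⟨h, hj⟩
    obtain ⟨b, rfl⟩ := Fin.exists_succAbove_eq hj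
    exact ⟨i, b, h, rfl, rfl⟩

theorem card_deleteColumn (S : Finset (Fin n × Fin (m + 1))) (j₀ : Fin (m + 1)) :
    #(deleteColumn S j₀) + colDeg S j₀ = #S := by
  rw [← card_image_of_injective _ (prodMap_succAbove_injective j₀), image_deleteColumn, add_comm]
  exact card_filter_add_card_filter_not _

theorem colDeg_deleteColumn (S : Finset (Fin n × Fin (m + 1))) (j₀ : Fin (m + 1)) (j : Fin m) :
    colDeg (deleteColumn S j₀) j = colDeg S (j₀.succAbove j) := by
  unfold colDeg
  rw [← card_image_of_injective _ (prodMap_succAbove_injective j₀)]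
  congr 1
  ext ⟨a, b⟩
  simp only [mem_image, mem_filter, Prod.exists, Prod.map_apply, id, Prod.mk.injEq,
    mem_deleteColumn]
  constructor
  · rintro ⟨a, b, ⟨h, rfl⟩, rfl, rfl⟩
    exact ⟨h, rfl⟩
  · rintro ⟨h, rfl⟩
    exact ⟨a, j, ⟨h, rfl⟩, rfl, rfl⟩

theorem rowDeg_deleteColumn (S : Finset (Fin n × Fin (m + 1))) (j₀ : Fin (m + 1)) (i : Fin n) :
    rowDeg (deleteColumn S j₀) i + (if (i, j₀) ∈ S then 1 else 0) = rowDeg S i := by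
  have h : rowDeg (deleteColumn S j₀) i = #(({p ∈ S | p.1 = i}).erase (i, j₀)) := by
    unfold rowDeg
    rw [← card_image_of_injective _ (prodMap_succAbove_injective j₀)]
    congr 1
    ext ⟨a, b⟩
    simp only [mem_image, mem_filter, Prod.exists, Prod.map_apply, id, Prod.mk.injEq,
      mem_deleteColumn, mem_erase, ne_eq]
    constructor
    · rintro ⟨a, b, ⟨h, rfl⟩, rfl, rfl⟩
      exact ⟨fun h => Fin.succAbove_ne _ _ h.2, h, rfl⟩
    · rintro ⟨hj, h, rfl⟩
      obtain ⟨b, rfl⟩ := Fin.exists_succAbove_eq (fun hb : b = j₀ => hj ⟨rfl, hb⟩)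
      exact ⟨a, b, ⟨h, rfl⟩, rfl, rfl⟩
  rw [h, card_erase_eq_ite]
  by_cases hm : (i, j₀) ∈ S
  · have := rowDeg_pos hm
    unfold rowDeg at *
    simp only [mem_filter, hm, and_self, if_true]
    omega
  · simp [hm, rowDeg]

theorem gammaXt_le_of_colDeg_eq_zero {S : Finset (Fin n × Fin (m + 1))} (h : Dominating S)
    {j₀ : Fin (m + 1)} (hj : colDeg S j₀ = 0) : gammaXt 3 n m ≤ #S := by
  have hcard := card_deleteColumn S j₀
  refine gammaXt_le_of_dominating (S := deleteColumn S j₀) (fun i j => ?_) (by omega)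
  have hr := rowDeg_deleteColumn S j₀ i
  have hnot : (i, j₀) ∉ S := fun hm => by
    have := colDeg_pos hm
    omega
  rw [if_neg hnot, add_zero] at hr
  rw [hr, colDeg_deleteColumn, mem_deleteColumn]
  exact h _ _

/-- The single cell of the deleted column is moved to a free place of its row. -/
theorem gammaXt_le_of_colDeg_eq_one (hm : 4 ≤ m) {S : Finset (Fin n × Fin (m + 1))}
    (h : Dominating S) {j₀ : Fin (m + 1)} (hj : colDeg S j₀ = 1) : gammaXt 3 n m ≤ #S := by
  obtain ⟨⟨i₀, b⟩, hp⟩ := card_eq_one.1 hj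
  have hmem : (i₀, b) ∈ ({p ∈ S | p.2 = j₀} : Finset _) := hp ▸ mem_singleton_self _
  obtain ⟨hS₀, rfl⟩ := mem_filter.1 hmem
  dsimp only at *
  have huniq : ∀ i, (i, b) ∈ S → i = i₀ := fun i hi => by
    have : (i, b) ∈ ({p ∈ S | p.2 = b} : Finset _) := mem_filter.2 ⟨hi, rfl⟩
    rw [hp] at this
    exact congrArg Prod.fst (mem_singleton.1 this)
  have hcard := card_deleteColumn S b
  have hr₀ := rowDeg_deleteColumn S b i₀
  rw [if_pos hS₀] at hr₀
  have h₀ := (h i₀ b).2 hS₀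
  obtain ⟨T, hT, hTc, hTr, hTS⟩ : ∃ T, deleteColumn S b ⊆ T ∧ #T ≤ #S ∧ 4 ≤ rowDeg T i₀ ∧
      ∀ i j, i ≠ i₀ → (i, j) ∈ T → (i, j) ∈ deleteColumn S b := by
    by_cases hfull : ∀ j, (i₀, j) ∈ deleteColumn S b
    · exact ⟨deleteColumn S b, subset_rfl, by omega,
        hm.trans (card_le_rowDeg id Function.injective_id hfull), fun _ _ _ h => h⟩
    · push Not at hfull
      obtain ⟨j, hj⟩ := hfull
      refine ⟨insert (i₀, j) (deleteColumn S b), subset_insert _ _,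
        (card_insert_le _ _).trans (by omega), ?_, fun i j' hi hm => ?_⟩
      · rw [rowDeg_insert hj]
        omega
      · exact (mem_insert.1 hm).resolve_left fun he => hi (congrArg Prod.fst he)
  refine gammaXt_le_of_dominating (S := T) (fun i j => ?_) hTc
  have hc := colDeg_mono hT j
  rw [colDeg_deleteColumn] at hc
  by_cases hi : i = i₀
  · subst hi
    refine ⟨by omega, fun hij => ?_⟩
    have := colDeg_pos hij
    omega
  · have hr := rowDeg_deleteColumn S b i
    rw [if_neg (fun hm => hi (huniq i hm))] at hr
    have hr' := rowDeg_mono hT i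
    have hS := h i (b.succAbove j)
    refine ⟨by omega, fun hij => ?_⟩
    have := hS.2 (mem_deleteColumn.1 (hTS i j hi hij))
    omega

end DeleteColumn

theorem gammaXt_le_succ {n m : ℕ} (hn : 3 ≤ n) (hnm : n ≤ m) :
    gammaXt 3 n m ≤ gammaXt 3 n (m + 1) := by
  obtain ⟨S, hS, hcard⟩ := exists_dominating_card_eq_gammaXt hn (m := m + 1) (by omega)
  rw [← hcard]
  by_cases hc : ∀ j, 2 ≤ colDeg S j
  · have := hS.three_mul_le_or_weighted_le hc
    exact gammaXt_le_of_weighted hn hnm (by omega)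
  · push Not at hc
    obtain ⟨j, hj⟩ := hc
    rcases Nat.eq_zero_or_pos (colDeg S j) with h0 | h0
    · exact gammaXt_le_of_colDeg_eq_zero hS h0
    · have h1 : colDeg S j = 1 := by omega
      rcases Nat.lt_or_ge m 4 with hm | hm
      · obtain rfl : m = 3 := by omega
        obtain rfl : n = 3 := by omega
        refine gammaXt_le_of_weighted le_rfl le_rfl (Or.inr ?_)
        obtain ⟨⟨i, b⟩, hp⟩ := card_pos.1 h0
        obtain ⟨hib, rfl⟩ := mem_filter.1 hp
        have hi := (hS i b).2 hib
        dsimp only at *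
        have hsum := sum_rowDeg S
        rw [Fin.sum_univ_three] at hsum
        have r0 := (hS 0 b).1
        have r1 := (hS 1 b).1
        have r2 := (hS 2 b).1
        fin_cases i <;> simp at hi <;> omega
      · exact gammaXt_le_of_colDeg_eq_one hm hS h1

theorem stmt_9 (n m : ℕ) (hn : 3 ≤ n) (hnm : n ≤ m) :
    gammaXt 3 n m ≤ gammaXt 3 n (m + 1) ∧
    gammaXt 3 n (m + 1) ≤ gammaXt 3 n m + 1 := by
  exact ⟨gammaXt_le_succ hn hnm, gammaXt_succ_le hn hnm⟩
end

section
/- Let m ≥ n ≥ 3, let S be an n × m 3TDS matrix with no all-zero columns and no all-zero rows, let 1 ≤ k ≤ n − 1, and assume S has exactly 2n + k ones. Then |S| ≥ 3m − 2k − 4⌊k/2⌋. -/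
/-- An `n × m` `(0,1)`-matrix is a `3`TDS matrix if `𝔯(i) + 𝔠(j) - 2 s_{ij} ≥ 3`
for all `i`, `j` (stated additively to avoid truncated subtraction). -/
def Is3TDSMatrix {n m : ℕ} (S : Matrix (Fin n) (Fin m) ℕ) : Prop :=
  (∀ i j, S i j = 0 ∨ S i j = 1) ∧
  ∀ i j, 3 + 2 * S i j ≤ (∑ j' : Fin m, S i j') + (∑ i' : Fin n, S i' j)

open Finset

/-- The number of indices at which `f` is at least `t`. -/
def countGE {ι : Type*} [Fintype ι] (f : ι → ℕ) (t : ℕ) : ℕ := ∑ i, if t ≤ f i then 1 else 0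

/-- The number of indices at which `f` equals `t`. -/
def countEQ {ι : Type*} [Fintype ι] (f : ι → ℕ) (t : ℕ) : ℕ := ∑ i, if f i = t then 1 else 0

/-- The sum of the values of `f` that are at least `t`. -/
def weightGE {ι : Type*} [Fintype ι] (f : ι → ℕ) (t : ℕ) : ℕ := ∑ i, if t ≤ f i then f i else 0

section Counting

variable {ι : Type*} [Fintype ι] (f : ι → ℕ) (t : ℕ)

theorem countGE_eq_add : countGE f t = countEQ f t + countGE f (t + 1) := by
  unfold countGE countEQ
  rw [← sum_add_distrib]
  refine sum_congr rfl fun i _ => ?_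
  split_ifs <;> omega

theorem weightGE_eq_add : weightGE f t = t * countEQ f t + weightGE f (t + 1) := by
  unfold weightGE countEQ
  rw [mul_sum, ← sum_add_distrib]
  refine sum_congr rfl fun i _ => ?_
  split_ifs <;> simp only [mul_one, mul_zero] <;> omega

theorem mul_countGE_le_weightGE : t * countGE f t ≤ weightGE f t := by
  unfold weightGE countGE
  rw [mul_sum]
  refine sum_le_sum fun i _ => ?_
  split_ifs <;> simp; omega

variable {f t}

theorem countGE_eq_card (h : ∀ i, t ≤ f i) : countGE f t = Fintype.card ι := by
  simp [countGE, h]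

theorem weightGE_eq_sum (h : ∀ i, t ≤ f i) : weightGE f t = ∑ i, f i := by
  simp [weightGE, h]

end Counting

/-- If every positive entry of a matrix lies in a row of sum at least `t` or in a column of sum at
least `u`, then these rows and columns cover the total sum. -/
theorem sum_le_weightGE_add_weightGE {ι κ : Type*} [Fintype ι] [Fintype κ] (S : Matrix ι κ ℕ)
    (t u : ℕ) (h : ∀ i j, S i j ≠ 0 → t ≤ ∑ j', S i j' ∨ u ≤ ∑ i', S i' j) :
    ∑ i, ∑ j, S i j ≤
      weightGE (fun i => ∑ j, S i j) t + weightGE (fun j => ∑ i, S i j) u := by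
  have hr : weightGE (fun i => ∑ j, S i j) t =
      ∑ i, ∑ j, if t ≤ ∑ j', S i j' then S i j else 0 := by
    unfold weightGE
    refine sum_congr rfl fun i _ => ?_
    split_ifs <;> simp
  have hc : weightGE (fun j => ∑ i, S i j) u =
      ∑ i, ∑ j, if u ≤ ∑ i', S i' j then S i j else 0 := by
    unfold weightGE
    rw [sum_comm]
    refine sum_congr rfl fun j _ => ?_
    split_ifs <;> simp
  rw [hr, hc, ← sum_add_distrib]
  refine sum_le_sum fun i _ => ?_
  rw [← sum_add_distrib]
  refine sum_le_sum fun j _ => ?_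
  have := h i j
  split_ifs <;> omega

theorem Is3TDSMatrix.sum_le_weightGE_add_weightGE {n m : ℕ} {S : Matrix (Fin n) (Fin m) ℕ}
    (hS : Is3TDSMatrix S) {t u : ℕ} (htu : t + u ≤ 6) :
    ∑ i, ∑ j, S i j ≤
      weightGE (fun i => ∑ j, S i j) t + weightGE (fun j => ∑ i, S i j) u := by
  refine _root_.sum_le_weightGE_add_weightGE S t u fun i j hij => ?_
  have h₁ := hS.1 i j
  have h₂ := hS.2 i j
  omega

theorem stmt_12 (n m k : ℕ) (hn : 3 ≤ n) (hnm : n ≤ m)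
    (S : Matrix (Fin n) (Fin m) ℕ) (hS : Is3TDSMatrix S)
    (hrow : ∀ i, ∃ j, S i j = 1) (hcol : ∀ j, ∃ i, S i j = 1)
    (hk1 : 1 ≤ k) (hk2 : k ≤ n - 1)
    (hcard : ∑ i : Fin n, ∑ j : Fin m, S i j = 2 * n + k) :
    3 * m - 2 * k - 4 * (k / 2) ≤ ∑ i : Fin n, ∑ j : Fin m, S i j := by
  have hr1 : ∀ i, 1 ≤ ∑ j, S i j := fun i => by
    obtain ⟨j, hj⟩ := hrow i
    exact hj ▸ single_le_sum (f := fun j => S i j) (fun _ _ => Nat.zero_le _) (mem_univ j)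
  have hc1 : ∀ j, 1 ≤ ∑ i, S i j := fun j => by
    obtain ⟨i, hi⟩ := hcol j
    exact hi ▸ single_le_sum (f := fun i => S i j) (fun _ _ => Nat.zero_le _) (mem_univ i)
  have hT : ∑ j, ∑ i, S i j = 2 * n + k := by rw [sum_comm, hcard]
  have e33 := hS.sum_le_weightGE_add_weightGE (t := 3) (u := 3) (by norm_num)
  have e24 := hS.sum_le_weightGE_add_weightGE (t := 2) (u := 4) (by norm_num)
  have e42 := hS.sum_le_weightGE_add_weightGE (t := 4) (u := 2) (by norm_num)
  rw [hcard] at e33 e24 e42 ⊢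
  have hone : (∀ i, 2 ≤ ∑ j, S i j) ∨ ∀ j, 2 ≤ ∑ i, S i j := by
    by_contra! h
    obtain ⟨⟨i, hi⟩, j, hj⟩ := h
    have := hS.2 i j
    omega
  have hrn := countGE_eq_card hr1
  have hcm := countGE_eq_card hc1
  have hrT := (weightGE_eq_sum hr1).trans hcard
  have hcT := (weightGE_eq_sum hc1).trans hT
  have hr2 : (∀ i, 2 ≤ ∑ j, S i j) →
      countGE (fun i => ∑ j, S i j) 2 = n := fun h => by
    simpa using countGE_eq_card h
  have hc2 : (∀ j, 2 ≤ ∑ i, S i j) →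
      countGE (fun j => ∑ i, S i j) 2 = m := fun h => by
    simpa using countGE_eq_card h
  rw [Fintype.card_fin] at hrn hcm
  generalize (fun i => ∑ j, S i j) = r at *
  generalize (fun j => ∑ i, S i j) = c at *
  have r1 := countGE_eq_add r 1
  have r2 := countGE_eq_add r 2
  have r3 := countGE_eq_add r 3
  have c1 := countGE_eq_add c 1
  have c2 := countGE_eq_add c 2
  have c3 := countGE_eq_add c 3
  have wr1 := weightGE_eq_add r 1
  have wr2 := weightGE_eq_add r 2
  have wr3 := weightGE_eq_add r 3
  have wc1 := weightGE_eq_add c 1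
  have wc2 := weightGE_eq_add c 2
  have wc3 := weightGE_eq_add c 3
  have lr3 := mul_countGE_le_weightGE r 3
  have lr4 := mul_countGE_le_weightGE r 4
  have lc3 := mul_countGE_le_weightGE c 3
  have lc4 := mul_countGE_le_weightGE c 4
  norm_num at r1 r2 r3 c1 c2 c3 wr1 wr2 wr3 wc1 wc2 wc3
  rcases hone with h | h
  · have := hr2 h
    have hm : 6 * m ≤ 4 * weightGE r 4 + 3 * countEQ r 3 + 4 * n + 2 * k := by omega
    have hk : k + 2 * countGE r 4 = countEQ r 3 + weightGE r 4 := by omega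
    clear * - hm hk lr4
    obtain ⟨x, hx⟩ := Nat.exists_eq_add_of_le lr4
    omega
  · have := hc2 h
    obtain ⟨x₁, h₁⟩ := Nat.exists_eq_add_of_le lr3
    obtain ⟨x₂, h₂⟩ : ∃ x, weightGE r 3 = 2 * countEQ c 2 + x :=
      Nat.exists_eq_add_of_le (by omega)
    obtain ⟨x₃, h₃⟩ : ∃ x, weightGE c 4 = countEQ r 1 + x :=
      Nat.exists_eq_add_of_le (by omega)
    obtain ⟨x₄, h₄⟩ := Nat.exists_eq_add_of_le lc4
    have hslack : x₁ + x₂ + x₃ + 2 * x₄ + countEQ r 2 + countEQ c 3 + 8 * m = 5 * k + 7 * n := by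
      omega
    have hrows : countEQ r 2 + 2 * countGE r 3 + x₁ = n + k := by omega
    have ha : countEQ r 1 + countEQ r 2 + countGE r 3 = n := by omega
    have ha' : countEQ r 1 + x₃ = 4 * countGE c 4 + x₄ := by omega
    clear * - hslack hrows ha ha' hnm
    by_contra! hlt
    have hmn : m = n := by omega
    have hodd : k % 2 = 1 := by omega
    have : countEQ r 2 + x₁ + n = 5 * k := by omega
    omega
end

section
/- Let n ≥ 3 and let r with 0 ≤ r ≤ 9 be such that n ≡ r (mod 10). Then γ_{×3,t}(K_n □ K_n) = 2n + 2⌊n/10⌋ + 2 if r ∈ {4,5,6,7,8,9}; γ_{×3,t}(K_n □ K_n) = 2n + 2⌊n/10⌋ + ⌈r/3⌉ if r ∈ {0,1,2,3} and n ≠ 3; and γ_{×3,t}(K_3 □ K_3) = 8. -/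
open SimpleGraph

open Finset in
/-- The combinatorial form of 3-tuple total domination of a rook's graph: the row and column
sizes of the relation sum to at least 3 on every cell, and to at least 5 on every chosen cell. -/
def RookDominating {α β : Type*} [Fintype α] [Fintype β] (R : α → β → Prop) [DecidableRel R] :
    Prop :=
  ∀ u v, 3 + (if R u v then 2 else 0) ≤ #{v' | R u v'} + #{u' | R u' v}

namespace RookDominating

open Finset

section LowerBound

variable {α β : Type*} [Fintype α] [Fintype β] {R : α → β → Prop} [DecidableRel R]

theorem swap (h : RookDominating R) : RookDominating fun v u => R u v :=
  fun v u => by rw [add_comm #_]; exact h u v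

theorem sum_card_col (R : α → β → Prop) [DecidableRel R] :
    ∑ v, #{u | R u v} = ∑ u, #{v | R u v} :=
  (sum_card_bipartiteAbove_eq_sum_card_bipartiteBelow R).symm

/-- A column of a dominating relation pays for itself and for its share of the rows it meets. -/
theorem column_weight (h : RookDominating R) (ha : ∀ u, 1 ≤ #{v | R u v})
    (hb : ∀ v, 2 ≤ #{u | R u v}) (v : β) :
    8 + 3 * ∑ u with R u v, (1 / #{v' | R u v'} : ℚ) + (if Odd #{u | R u v} then 2 else 0) ≤
      5 * #{u | R u v} := by
  have bound (k : ℕ) (hk : 0 < k) (hrow : ∀ u, R u v → k ≤ #{v' | R u v'}) :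
      ∑ u with R u v, (1 / #{v' | R u v'} : ℚ) ≤ #{u | R u v} * (1 / k) := by
    rw [← nsmul_eq_mul]
    refine sum_le_card_nsmul _ _ _ fun u hu => ?_
    exact one_div_le_one_div_of_le (by exact_mod_cast hk)
      (by exact_mod_cast hrow u (by simpa using hu))
  have key (u : α) (hu : R u v) : 5 ≤ #{v' | R u v'} + #{u' | R u' v} := by
    simpa [hu] using h u v
  have h2 := hb v
  generalize hc : #{u | R u v} = c at *
  obtain rfl | rfl | rfl | h5 : c = 2 ∨ c = 3 ∨ c = 4 ∨ 5 ≤ c := by omega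
  · have := bound 3 (by norm_num) fun u hu => by have := key u hu; omega
    rw [if_neg (by decide)]
    norm_num at this ⊢
    linarith
  · have := bound 2 (by norm_num) fun u hu => by have := key u hu; omega
    rw [if_pos (by decide)]
    norm_num at this ⊢
    linarith
  · have := bound 1 (by norm_num) fun u _ => ha u
    rw [if_neg (by decide)]
    norm_num at this ⊢
    linarith
  · have := bound 1 (by norm_num) fun u _ => ha u
    have h5' : (5 : ℚ) ≤ c := by exact_mod_cast h5
    have hodd : (if Odd c then 2 else 0 : ℚ) ≤ 2 := by split_ifs <;> norm_num
    norm_num only [Nat.cast_one, div_one, mul_one] at this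
    linarith

theorem sum_row_share (ha : ∀ u, 1 ≤ #{v | R u v}) :
    ∑ v, ∑ u with R u v, (1 / #{v' | R u v'} : ℚ) = Fintype.card α := by
  simp_rw [sum_filter]
  rw [sum_comm]
  have (u : α) : ∑ v, (if R u v then (1 / #{v' | R u v'} : ℚ) else 0) = 1 := by
    rw [← sum_filter, sum_const, nsmul_eq_mul, mul_one_div_cancel]
    have := ha u
    exact_mod_cast (by omega : #{v' | R u v'} ≠ 0)
  simp only [this, sum_const, card_univ, nsmul_eq_mul, mul_one]

theorem size_bound_of_two_le_col (h : RookDominating R) (ha : ∀ u, 1 ≤ #{v | R u v})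
    (hb : ∀ v, 2 ≤ #{u | R u v}) :
    3 * Fintype.card α + 8 * Fintype.card β ≤ 5 * ∑ u, #{v | R u v} ∧
      (5 * ∑ u, #{v | R u v} ≤ 3 * Fintype.card α + 8 * Fintype.card β + 1 →
        Even (∑ u, #{v | R u v})) := by
  have total := sum_le_sum fun v (_ : v ∈ univ) => column_weight h ha hb v
  simp_rw [sum_add_distrib, ← mul_sum, ← Nat.cast_sum, sum_row_share ha] at total
  rw [sum_card_col] at total
  simp only [sum_const, card_univ, nsmul_eq_mul] at total
  have nonneg (v : β) : (0 : ℚ) ≤ if Odd #{u | R u v} then 2 else 0 := by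
    split_ifs <;> norm_num
  constructor
  · have : (3 * Fintype.card α + 8 * Fintype.card β : ℚ) ≤ 5 * (∑ u, #{v | R u v} : ℕ) := by
      have := sum_nonneg fun v (_ : v ∈ univ) => nonneg v
      linarith
    exact_mod_cast this
  · intro hle
    rw [← sum_card_col]
    refine even_sum _ fun v _ => ?_
    by_contra hv
    rw [Nat.not_even_iff_odd] at hv
    have hsingle := single_le_sum (fun v _ => nonneg v) (mem_univ v)
    rw [if_pos hv] at hsingle
    have hle' : (5 * (∑ u, #{v | R u v} : ℕ) : ℚ) ≤
        3 * Fintype.card α + 8 * Fintype.card β + 1 := by exact_mod_cast hle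
    linarith

theorem size_ge_of_row_empty (h : RookDominating R) {u : α} (hu : #{v | R u v} = 0) :
    3 * Fintype.card β ≤ ∑ u, #{v | R u v} := by
  rw [← sum_card_col, mul_comm, ← smul_eq_mul, ← card_univ]
  refine card_nsmul_le_sum _ _ _ fun v _ => ?_
  have := h u v
  omega

theorem size_bound {n : ℕ} (hn : 1 ≤ n) {R : Fin n → Fin n → Prop} [DecidableRel R]
    (h : RookDominating R) :
    11 * n ≤ 5 * ∑ u, #{v | R u v} ∧
      (5 * ∑ u, #{v | R u v} ≤ 11 * n + 1 → Even (∑ u, #{v | R u v})) := by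
  have large (hs : 3 * n ≤ ∑ u, #{v | R u v}) :
      11 * n ≤ 5 * ∑ u, #{v | R u v} ∧
        (5 * ∑ u, #{v | R u v} ≤ 11 * n + 1 → Even (∑ u, #{v | R u v})) :=
    ⟨by omega, by omega⟩
  by_cases ha : ∃ u, #{v | R u v} = 0
  · obtain ⟨u, hu⟩ := ha
    exact large (by simpa using h.size_ge_of_row_empty hu)
  by_cases hb : ∃ v, #{u | R u v} = 0
  · obtain ⟨v, hv⟩ := hb
    have := h.swap.size_ge_of_row_empty hv
    rw [sum_card_col] at this
    exact large (by simpa using this)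
  push Not at ha hb
  replace ha u := Nat.one_le_iff_ne_zero.2 (ha u)
  replace hb v := Nat.one_le_iff_ne_zero.2 (hb v)
  have arrange : 3 * n + 8 * n = 11 * n := by ring
  by_cases hb2 : ∀ v, 2 ≤ #{u | R u v}
  · simpa [arrange] using h.size_bound_of_two_le_col ha hb2
  · push Not at hb2
    obtain ⟨v, hv⟩ := hb2
    have ha2 (u : Fin n) : 2 ≤ #{v | R u v} := by
      have := h u v
      omega
    have := h.swap.size_bound_of_two_le_col hb ha2
    rw [sum_card_col] at this
    simpa [arrange] using this

theorem eight_le_size {R : Fin 3 → Fin 3 → Prop} [DecidableRel R] (h : RookDominating R) :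
    8 ≤ ∑ u, #{v | R u v} := by
  have key : ∀ f : Fin 3 → Fin 3 → Bool, RookDominating (fun u v => f u v = true) →
      8 ≤ ∑ u, #{v | f u v = true} := by
    unfold RookDominating
    decide +kernel
  have := key (fun u v => decide (R u v))
  simp only [decide_eq_true_eq] at this
  exact this (by convert h)

end LowerBound

section Construction

/-- The rows below `t` are dealt out cyclically to the columns below `x`; each column from `x` on
meets two consecutive rows, in the cyclic order of the rows from `t` on. -/
def CyclicPlacement (n t x : ℕ) (u v : Fin n) : Prop :=
  (u < t ∧ u % x = (v : ℕ)) ∨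
    (t ≤ u ∧ x ≤ v ∧ (t + 2 * (v - x) % (n - t) = u ∨ t + (2 * (v - x) + 1) % (n - t) = u))

instance (n t x : ℕ) : DecidableRel (CyclicPlacement n t x) := fun _ _ => by
  unfold CyclicPlacement; infer_instance

variable {n t x : ℕ}

theorem le_card_filter_of_injective {k : ℕ} {P : Fin n → Prop} [DecidablePred P] (f : Fin k → ℕ)
    (hf : Function.Injective f) (hlt : ∀ i, f i < n) (hP : ∀ i, P ⟨f i, hlt i⟩) :
    k ≤ #{u | P u} := by
  simpa using card_le_card_of_injOn (s := (univ : Finset (Fin k))) (fun i => ⟨f i, hlt i⟩)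
    (fun i _ => by simpa using hP i) (fun i _ j _ hij => hf (by simpa using hij))

theorem cyclicPlacement_size_le :
    ∑ u, #{v | CyclicPlacement n t x u v} ≤ t + 2 * (n - x) := by
  rw [← card_sigma, ← card_map ⟨fun p : (_ : Fin n) × Fin n => ((p.1 : ℕ), (p.2 : ℕ)), by
    rintro ⟨a, b⟩ ⟨c, d⟩ h; simpa [Fin.ext_iff] using h⟩]
  calc _ ≤ #((range t).image (fun i => (i, i % x)) ∪
        (range (2 * (n - x))).image fun k => (t + k % (n - t), x + k / 2)) := by
        refine card_le_card fun p hp => ?_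
        simp only [mem_map, mem_sigma, mem_univ, mem_filter, true_and] at hp
        obtain ⟨⟨u, v⟩, h, rfl⟩ := hp
        have hv := v.isLt
        change CyclicPlacement n t x u v at h
        change ((u : ℕ), (v : ℕ)) ∈ _
        simp only [mem_union, mem_image, mem_range, Prod.mk.injEq]
        obtain ⟨hu, hx⟩ | ⟨-, hx, h | h⟩ := h
        · exact .inl ⟨u, hu, rfl, hx⟩
        · exact .inr ⟨2 * (v - x), by omega, h, by omega⟩
        · exact .inr ⟨2 * (v - x) + 1, by omega, h, by omega⟩
    _ ≤ _ := (card_union_le _ _).trans <| by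
        simpa using add_le_add (card_image_le (s := range t) (f := fun i => (i, i % x)))
          (card_image_le (s := range (2 * (n - x))) (f := fun k => (t + k % (n - t), x + k / 2)))

theorem cyclicPlacement_of_mod (u : Fin n) {v : Fin n} {k : ℕ} (hu : t ≤ u) (hv : x + k / 2 = v)
    (hk : t + k % (n - t) = u) : CyclicPlacement n t x u v := by
  refine .inr ⟨hu, by omega, ?_⟩
  obtain h | h := Nat.mod_two_eq_zero_or_one k
  · left; rwa [show 2 * ((v : ℕ) - x) = k by omega]
  · right; rwa [show 2 * ((v : ℕ) - x) + 1 = k by omega]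

theorem cyclicPlacement (hx : 1 ≤ x) (hxt : 4 * x ≤ t) (ht : t + 2 ≤ n)
    (hrows : 3 * (n - t) ≤ 2 * (n - x)) : RookDominating (CyclicPlacement n t x) := by
  have row_light (u : Fin n) (hu : u < t) : 1 ≤ #{v | CyclicPlacement n t x u v} := by
    have hlt := Nat.mod_lt u hx
    exact le_card_filter_of_injective (fun _ => u % x) (Function.injective_of_subsingleton _)
      (fun _ => by omega) fun _ => .inl ⟨hu, rfl⟩
  have row_heavy (u : Fin n) (hu : t ≤ u) : 3 ≤ #{v | CyclicPlacement n t x u v} := by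
    have hun := u.isLt
    refine le_card_filter_of_injective (fun i => x + (u - t + (n - t) * i) / 2) ?_ ?_ ?_
    · intro i j hij
      fin_cases i <;> fin_cases j <;> simp at hij ⊢ <;> omega
    · intro i
      fin_cases i <;> simp <;> omega
    · intro i
      refine cyclicPlacement_of_mod u hu rfl ?_
      rw [Nat.add_mul_mod_self_left, Nat.mod_eq_of_lt (by omega)]
      omega
  have col_heavy (v : Fin n) (hv : v < x) : 4 ≤ #{u | CyclicPlacement n t x u v} := by
    refine le_card_filter_of_injective (fun i => v + x * i) ?_ ?_ ?_
    · intro i j hij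
      exact Fin.ext (Nat.eq_of_mul_eq_mul_left hx (Nat.add_left_cancel hij))
    · intro i
      fin_cases i <;> simp <;> omega
    · intro i
      refine .inl ⟨?_, ?_⟩
      · fin_cases i <;> simp <;> omega
      · simpa using Nat.mod_eq_of_lt hv
  have col_light (v : Fin n) (hv : x ≤ v) : 2 ≤ #{u | CyclicPlacement n t x u v} := by
    have hpos : 0 < n - t := by omega
    have hlt (k : ℕ) : t + k % (n - t) < n := by have := Nat.mod_lt k hpos; omega
    refine le_card_filter_of_injective (fun i => t + (2 * (v - x) + i) % (n - t)) ?_ ?_ ?_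
    · intro i j hij
      have : (2 * (v - x) + i) ≡ (2 * (v - x) + j) [MOD n - t] := Nat.add_left_cancel hij
      have := Nat.ModEq.add_left_cancel' _ this
      exact Fin.ext (this.eq_of_lt_of_lt (by omega) (by omega))
    · exact fun i => hlt _
    · intro i
      exact cyclicPlacement_of_mod _ (by simp) (by omega) rfl
  intro u v
  have col : 2 ≤ #{u | CyclicPlacement n t x u v} := by
    by_cases hv : v < x
    · exact le_trans (by norm_num) (col_heavy v hv)
    · exact col_light v (by omega)
  by_cases hu : u < t
  · have := row_light u hu
    split_ifs with huv
    · have hv : v < x := by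
        obtain ⟨-, h⟩ | ⟨h, -⟩ := huv
        · exact h ▸ Nat.mod_lt _ hx
        · omega
      have := col_heavy v hv
      omega
    · omega
  · have := row_heavy u (by omega)
    split_ifs <;> omega

end Construction

section Rook

variable {n m : ℕ}

theorem ncard_eq_sum (R : Fin n → Fin m → Prop) [DecidableRel R] :
    {p : Fin n × Fin m | R p.1 p.2}.ncard = ∑ u, #{v | R u v} := by
  rw [Set.ncard_eq_toFinset_card', Set.toFinset_ofPred, ← univ_product_univ, card_filter,
    sum_product]
  simp_rw [card_filter]

theorem ncard_inter_neighborSet (R : Fin n → Fin m → Prop) [DecidableRel R] (u : Fin n)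
    (v : Fin m) :
    ({p : Fin n × Fin m | R p.1 p.2} ∩ (rook n m).neighborSet (u, v)).ncard +
      (if R u v then 2 else 0) = #{v' | R u v'} + #{u' | R u' v} := by
  have hset : {p : Fin n × Fin m | R p.1 p.2} ∩ (rook n m).neighborSet (u, v) =
      ((({v' | R u v'} : Finset (Fin m)).erase v).map (.sectR u (Fin m)) ∪
        (({u' | R u' v} : Finset (Fin n)).erase u).map (.sectL (Fin n) v) : Finset _) := by
    ext ⟨a, b⟩
    simp only [rook, mem_neighborSet, boxProd_adj, top_adj, Set.mem_inter_iff, Set.mem_ofPred_eq,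
      coe_union, coe_map, coe_erase, coe_filter, Set.mem_union, Set.mem_image, Set.mem_sdiff,
      Set.mem_singleton_iff, mem_univ, true_and, Function.Embedding.sectR_apply,
      Function.Embedding.sectL_apply, Prod.mk.injEq]
    grind
  rw [hset, Set.ncard_coe_finset, card_union_of_disjoint, card_map, card_map]
  · split_ifs with h
    · have h₁ := card_erase_add_one (s := ({v' | R u v'} : Finset (Fin m))) (a := v) (by simpa)
      have h₂ := card_erase_add_one (s := ({u' | R u' v} : Finset (Fin n))) (a := u) (by simpa)
      omega
    · rw [erase_eq_of_notMem (by simpa), erase_eq_of_notMem (by simpa), add_zero]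
  · rw [Finset.disjoint_left]
    simp only [mem_map, mem_erase]
    rintro _ ⟨b, hb, rfl⟩ ⟨a, ha, hab⟩
    simp only [Function.Embedding.sectR_apply, Function.Embedding.sectL_apply,
      Prod.mk.injEq] at hab
    exact ha.1 hab.1

theorem isTDS_rook_iff (R : Fin n → Fin m → Prop) [DecidableRel R] :
    IsTDS (rook n m) 3 {p | R p.1 p.2} ↔ RookDominating R := by
  simp_rw [IsTDS, RookDominating, Prod.forall, ← ncard_inter_neighborSet, add_le_add_iff_right]

theorem gammaXt_eq {c : ℕ} (R : Fin n → Fin m → Prop) [DecidableRel R] (h : RookDominating R)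
    (hc : ∑ u, #{v | R u v} ≤ c)
    (lower : ∀ (Q : Fin n → Fin m → Prop) [DecidableRel Q], RookDominating Q →
      c ≤ ∑ u, #{v | Q u v}) :
    gammaXt 3 n m = c := by
  have hR : ∑ u, #{v | R u v} ∈
      {c | ∃ S : Set (Fin n × Fin m), IsTDS (rook n m) 3 S ∧ S.ncard = c} :=
    ⟨_, (isTDS_rook_iff R).2 h, ncard_eq_sum R⟩
  refine le_antisymm ((Nat.sInf_le hR).trans hc) (le_csInf ⟨_, hR⟩ ?_)
  rintro _ ⟨S, hS, rfl⟩
  classical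
  exact (lower (fun u v => (u, v) ∈ S) ((isTDS_rook_iff _).1 hS)).trans_eq (ncard_eq_sum _).symm

theorem gammaXt_eq_of_cyclicPlacement {t x : ℕ} (hx : 1 ≤ x) (hxt : 4 * x ≤ t) (ht : t + 2 ≤ n)
    (hrows : 3 * (n - t) ≤ 2 * (n - x))
    (lower : ∀ s, 11 * n ≤ 5 * s → (5 * s ≤ 11 * n + 1 → Even s) → t + 2 * (n - x) ≤ s) :
    gammaXt 3 n n = t + 2 * (n - x) := by
  refine gammaXt_eq _ (cyclicPlacement hx hxt ht hrows) cyclicPlacement_size_le fun Q _ hQ => ?_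
  obtain ⟨h₁, h₂⟩ := hQ.size_bound (by omega)
  exact lower _ h₁ h₂

theorem gammaXt_three : gammaXt 3 3 3 = 8 :=
  gammaXt_eq (fun u v => (u, v) ≠ (0, 0)) (by unfold RookDominating; decide) (by decide)
    fun _ _ hQ => hQ.eight_le_size

theorem gammaXt_four : gammaXt 3 4 4 = 10 := by
  refine gammaXt_eq (fun u v => u < 2 ∧ 2 ≤ v ∨ 2 ≤ u ∧ v < 2 ∨ u < 2 ∧ u = v)
    (by unfold RookDominating; decide) (by decide) fun Q _ hQ => ?_
  obtain ⟨h₁, h₂⟩ := hQ.size_bound (by norm_num)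
  grind

theorem gammaXt_five : gammaXt 3 5 5 = 12 := by
  refine gammaXt_eq (fun u v => u < 2 ∧ v < 3 ∨ 2 ≤ u ∧ 3 ≤ v)
    (by unfold RookDominating; decide) (by decide) fun Q _ hQ => ?_
  obtain ⟨h₁, h₂⟩ := hQ.size_bound (by norm_num)
  grind

end Rook

end RookDominating

open RookDominating in
theorem stmt_13 (n r : ℕ) (hn : 3 ≤ n) (hr : r ≤ 9) (hmod : n % 10 = r) :
    (r ∈ ({4, 5, 6, 7, 8, 9} : Set ℕ) →
      gammaXt 3 n n = 2 * n + 2 * (n / 10) + 2) ∧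
    (r ∈ ({0, 1, 2, 3} : Set ℕ) ∧ n ≠ 3 →
      gammaXt 3 n n = 2 * n + 2 * (n / 10) + (r + 2) / 3) ∧
    (n = 3 → gammaXt 3 n n = 8) := by
  simp only [Set.mem_insert_iff, Set.mem_singleton_iff]
  refine ⟨fun h => ?_, fun ⟨h, h3⟩ => ?_, ?_⟩
  · obtain rfl | rfl | h6 : n = 4 ∨ n = 5 ∨ 6 ≤ n := by omega
    · exact gammaXt_four
    · exact gammaXt_five
    · rw [gammaXt_eq_of_cyclicPlacement (t := 4 * (n / 10) + 4) (x := n / 10 + 1)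
        (by omega) (by omega) (by omega) (by omega) ?_]
      · omega
      · intro s h₁ h₂
        rw [Nat.even_iff] at h₂
        omega
  · rw [gammaXt_eq_of_cyclicPlacement (t := 4 * (n / 10) + (r + 2) / 3) (x := n / 10)
      (by omega) (by omega) (by omega) (by omega) ?_]
    · omega
    · intro s h₁ h₂
      omega
  · rintro rfl
    exact gammaXt_three
end
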